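/- arXiv:1601.02812 — 10 statements merged into one kernel-verified Lean document; each statement's English description precedes it below -/
import Mathlib

section
/- Hopf-type boundary derivative estimates: Assume a² ≥ 0, b², c² > 0, let k ∈ ℤ \ {0} and let R ∈ (0,∞) be finite. Let (u,v) be a profile solution on (0,R) which extends to a C² pair on (0,R], with u > 0 and v < 0 on (0,R). If b⁴ < 3a²c², then u'(R) > 0 and v'(R) > 0. If b⁴ > 3a²c², then u'(R) > 0 and v'(R) < 0. -/
open Real MeasureTheory Filter Set Topology
open scoped ENNReal

noncomputable section

/-- `s₊ = (b² + √(b⁴ + 24 a² c²)) / (4c²)`, where `a2 = a²`, `b2 = b²`, `c2 = c²`. -/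
def sPlus (a2 b2 c2 : ℝ) : ℝ := (b2 + Real.sqrt (b2 ^ 2 + 24 * a2 * c2)) / (4 * c2)

/-- `h(p,q) = p(−a² + (2b²/√6)q + c²(p² + q²))`. -/
def hfun (a2 b2 c2 p q : ℝ) : ℝ :=
  p * (-a2 + 2 * b2 / Real.sqrt 6 * q + c2 * (p ^ 2 + q ^ 2))

/-- `g(p,q) = q(−a² − (b²/√6)q + c²(p² + q²)) + (b²/√6)p²`. -/
def gfun (a2 b2 c2 p q : ℝ) : ℝ :=
  q * (-a2 - b2 / Real.sqrt 6 * q + c2 * (p ^ 2 + q ^ 2)) + b2 / Real.sqrt 6 * p ^ 2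

/-- The interval `(0, R)` for `R ∈ (0,∞]`, as a subset of `ℝ`. -/
def Iset (R : ℝ≥0∞) : Set ℝ := {r : ℝ | 0 < r ∧ ENNReal.ofReal r < R}

/-- The filter of left-approach to the right endpoint `R`; `atTop` when `R = ∞`. -/
def endFilter (R : ℝ≥0∞) : Filter ℝ :=
  if R = ⊤ then Filter.atTop else nhdsWithin R.toReal (Set.Iio R.toReal)

/-- A profile solution on `(0,R)`: a C² pair `(u,v)` solving the radial ODE system with the
natural boundary conditions at `0` and at `R`. -/
structure ProfileSolution (a2 b2 c2 : ℝ) (k : ℤ) (R : ℝ≥0∞) (u v : ℝ → ℝ) : Prop where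
  smooth_u : ContDiffOn ℝ 2 u (Iset R)
  smooth_v : ContDiffOn ℝ 2 v (Iset R)
  ode_u : ∀ r ∈ Iset R,
    deriv (deriv u) r + deriv u r / r - (k : ℝ) ^ 2 / r ^ 2 * u r
      = hfun a2 b2 c2 (u r) (v r)
  ode_v : ∀ r ∈ Iset R,
    deriv (deriv v) r + deriv v r / r = gfun a2 b2 c2 (u r) (v r)
  bc0_u : Filter.Tendsto u (nhdsWithin 0 (Set.Ioi 0)) (nhds 0)
  bc0_v : Filter.Tendsto (deriv v) (nhdsWithin 0 (Set.Ioi 0)) (nhds 0)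
  bcR_u : Filter.Tendsto u (endFilter R) (nhds (sPlus a2 b2 c2 / Real.sqrt 2))
  bcR_v : Filter.Tendsto v (endFilter R) (nhds (-(sPlus a2 b2 c2 / Real.sqrt 6)))

theorem not_isLocalMax_of_deriv2_pos {f f1 : ℝ → ℝ} {x f2 : ℝ}
    (h1 : ∀ᶠ y in 𝓝 x, HasDerivAt f (f1 y) y) (h2 : HasDerivAt f1 f2 x)
    (hpos : f1 x = 0 → 0 < f2) : ¬ IsLocalMax f x := by
  intro hmax
  have hx : HasDerivAt f (f1 x) x := h1.self_of_nhds
  have h0 : f1 x = 0 := hmax.hasDerivAt_eq_zero hx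
  have hd : deriv f =ᶠ[𝓝 x] f1 := h1.mono fun y hy => hy.deriv
  have hdd : deriv (deriv f) x = f2 := by rw [hd.deriv_eq, h2.deriv]
  have hmin : IsLocalMin f x := by
    refine isLocalMin_of_deriv_deriv_pos ?_ ?_ hx.continuousAt
    · rw [hdd]; exact hpos h0
    · rw [hx.deriv, h0]
  have hconst : f =ᶠ[𝓝 x] fun _ => f x := by
    filter_upwards [hmax, hmin] with y hy hy' using le_antisymm hy hy'
  have : deriv (deriv f) x = 0 := by
    have h3 : deriv f =ᶠ[𝓝 x] fun _ => 0 := by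
      simpa using hconst.deriv
    rw [h3.deriv_eq]; simp
  have := hpos h0
  linarith

theorem le_of_not_isLocalMax {f : ℝ → ℝ} {R M l : ℝ}
    (hf : ContinuousOn f (Ioc 0 R)) (hl : Tendsto f (𝓝[>] 0) (𝓝 l)) (hfR : f R ≤ M)
    (h0 : M < l → ∃ r ∈ Ioo 0 R, l < f r)
    (hmax : ∀ r ∈ Ioo 0 R, M < f r → ¬ IsLocalMax f r) :
    ∀ r ∈ Ioc 0 R, f r ≤ M := by
  by_contra! ⟨r₀, hr₀, hM₀⟩
  obtain ⟨r₁, hr₁, hM₁, hl₁⟩ : ∃ r ∈ Ioc 0 R, M < f r ∧ l < f r := by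
    rcases le_or_gt l M with h | h
    · exact ⟨r₀, hr₀, hM₀, h.trans_lt hM₀⟩
    · obtain ⟨r, hr, hlr⟩ := h0 h
      exact ⟨r, Ioo_subset_Ioc_self hr, h.trans hlr, hlr⟩
  obtain ⟨d, hd0, hd⟩ := mem_nhdsGT_iff_exists_Ioo_subset.1 (hl.eventually_lt_const hl₁)
  have hd0 : 0 < d := hd0
  have hdr : d ≤ r₁ := by
    by_contra! h
    exact lt_irrefl (f r₁) (hd ⟨hr₁.1, h⟩)
  have hsub : Icc (d / 2) R ⊆ Ioc 0 R := fun x hx => ⟨by linarith [hx.1], hx.2⟩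
  have hr₁' : r₁ ∈ Icc (d / 2) R := ⟨by linarith, hr₁.2⟩
  obtain ⟨x, hx, hxmax⟩ := isCompact_Icc.exists_isMaxOn ⟨r₁, hr₁'⟩ (hf.mono hsub)
  have hfx : f r₁ ≤ f x := hxmax hr₁'
  have hxR : x < R := lt_of_le_of_ne hx.2 (by rintro rfl; linarith)
  have hxd : d / 2 < x := lt_of_le_of_ne hx.1 (by
    rintro rfl
    have : f (d / 2) < f r₁ := hd ⟨by linarith, by linarith⟩
    linarith)
  exact hmax x ⟨by linarith, hxR⟩ (hM₁.trans_le hfx)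
    (hxmax.isLocalMax (Icc_mem_nhds hxd hxR))

theorem StrictMonoOn.lt_of_tendsto_nhdsGT {f : ℝ → ℝ} {d l : ℝ}
    (hf : StrictMonoOn f (Ioo 0 d)) (hl : Tendsto f (𝓝[>] 0) (𝓝 l)) :
    ∀ r ∈ Ioo 0 d, l < f r := by
  intro r hr
  have hr2 : r / 2 ∈ Ioo 0 d := ⟨by linarith [hr.1], by linarith [hr.1, hr.2]⟩
  refine lt_of_le_of_lt ?_ (hf hr2 hr (by linarith [hr.1]))
  refine le_of_tendsto hl ?_
  filter_upwards [Ioo_mem_nhdsGT hr2.1] with x hx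
  exact (hf ⟨hx.1, hx.2.trans hr2.2⟩ hr2 hx.2).le

theorem strictMonoOn_Ioo_of_hasDerivAt_pos {f f1 : ℝ → ℝ} {a b : ℝ}
    (h : ∀ r ∈ Ioo a b, HasDerivAt f (f1 r) r) (hpos : ∀ r ∈ Ioo a b, 0 < f1 r) :
    StrictMonoOn f (Ioo a b) := by
  refine strictMonoOn_of_deriv_pos (convex_Ioo a b)
    (fun r hr => (h r hr).continuousAt.continuousWithinAt) ?_
  intro r hr
  rw [interior_Ioo] at hr
  rw [(h r hr).deriv]
  exact hpos r hr

theorem hasDerivAt_mul_radial {f1 : ℝ → ℝ} {f2 G r : ℝ} (hr : 0 < r)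
    (h : HasDerivAt f1 f2 r) (hG : f2 + f1 r / r = G) :
    HasDerivAt (fun x => x * f1 x) (r * G) r := by
  have := (hasDerivAt_id r).mul h
  refine this.congr_deriv ?_
  rw [← hG]
  simp only [id]
  field_simp
  ring

/-- A radial function with positive Laplacian near the origin and vanishing derivative at the
origin lies strictly above its value at the origin. -/
theorem eventually_gt_of_radial_laplacian_pos {f f1 f2 G : ℝ → ℝ} {R l : ℝ} (hR : 0 < R)
    (h1 : ∀ r ∈ Ioo 0 R, HasDerivAt f (f1 r) r)
    (h2 : ∀ r ∈ Ioo 0 R, HasDerivAt f1 (f2 r) r)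
    (hG : ∀ r ∈ Ioo 0 R, f2 r + f1 r / r = G r)
    (hl : Tendsto f (𝓝[>] 0) (𝓝 l)) (hl1 : Tendsto f1 (𝓝[>] 0) (𝓝 0))
    (hpos : ∀ᶠ r in 𝓝[>] 0, 0 < G r) : ∀ᶠ r in 𝓝[>] 0, l < f r := by
  obtain ⟨d, hd0, hd⟩ := mem_nhdsGT_iff_exists_Ioo_subset.1
    (inter_mem hpos (Ioo_mem_nhdsGT hR))
  have hR' : ∀ r ∈ Ioo 0 d, r ∈ Ioo 0 R := fun r hr => (hd hr).2
  have hG' : ∀ r ∈ Ioo 0 d, 0 < G r := fun r hr => (hd hr).1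
  have hP : StrictMonoOn (fun x => x * f1 x) (Ioo 0 d) :=
    strictMonoOn_Ioo_of_hasDerivAt_pos
      (fun r hr => hasDerivAt_mul_radial hr.1 (h2 r (hR' r hr)) (hG r (hR' r hr)))
      (fun r hr => mul_pos hr.1 (hG' r hr))
  have hP0 : Tendsto (fun x => x * f1 x) (𝓝[>] 0) (𝓝 0) := by
    have : Tendsto (fun x : ℝ => x) (𝓝[>] 0) (𝓝 0) := tendsto_id.mono_left nhdsWithin_le_nhds
    simpa using this.mul hl1
  have hf1 : ∀ r ∈ Ioo 0 d, 0 < f1 r := fun r hr =>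
    pos_of_mul_pos_right (hP.lt_of_tendsto_nhdsGT hP0 r hr) hr.1.le
  have hf := strictMonoOn_Ioo_of_hasDerivAt_pos (fun r hr => h1 r (hR' r hr)) hf1
  filter_upwards [Ioo_mem_nhdsGT hd0] with r hr using hf.lt_of_tendsto_nhdsGT hl r hr

theorem exists_tendsto_nhdsGT_of_tendsto_deriv {f f1 : ℝ → ℝ} {R : ℝ} (hR : 0 < R)
    (h1 : ∀ r ∈ Ioo 0 R, HasDerivAt f (f1 r) r) (hl1 : Tendsto f1 (𝓝[>] 0) (𝓝 0)) :
    ∃ l, Tendsto f (𝓝[>] 0) (𝓝 l) := by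
  obtain ⟨d, hd0, hd⟩ := mem_nhdsGT_iff_exists_Ioo_subset.1
    (inter_mem (hl1.norm.eventually_lt_const (by simp : ‖(0 : ℝ)‖ < 1)) (Ioo_mem_nhdsGT hR))
  have hL : LipschitzOnWith 1 f (Ioo 0 d) :=
    (convex_Ioo 0 d).lipschitzOnWith_of_nnnorm_hasDerivWithin_le
      (fun r hr => (h1 r (hd hr).2).hasDerivWithinAt) (fun r hr => (hd hr).1.le)
  obtain ⟨g, hg, hfg⟩ := hL.extend_real
  refine ⟨g 0, (hg.continuous.continuousAt.tendsto.mono_left nhdsWithin_le_nhds).congr' ?_⟩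
  filter_upwards [Ioo_mem_nhdsGT hd0] with r hr using (hfg hr).symm

theorem eventually_lt_of_hasDerivWithinAt_pos {f : ℝ → ℝ} {R f1 : ℝ} (hR : 0 < R)
    (h : HasDerivWithinAt f f1 (Ioc 0 R) R) (hpos : 0 < f1) :
    ∀ᶠ r in 𝓝[<] R, f r < f R := by
  have h' : HasDerivWithinAt f f1 (Iio R) R := by
    refine h.mono_of_mem_nhdsWithin ?_
    filter_upwards [Ioo_mem_nhdsLT hR] with r hr using ⟨hr.1, hr.2.le⟩
  have := (hasDerivWithinAt_iff_tendsto_slope' (by simp)).1 h'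
  filter_upwards [this.eventually_const_lt hpos, self_mem_nhdsWithin] with r hr hrR
  have hrR : r < R := hrR
  rw [slope_def_field, div_pos_iff] at hr
  rcases hr with hr | hr <;> linarith [hr.1, hr.2]

theorem eventually_lt_of_eventually_deriv_pos {f f1 : ℝ → ℝ} {R : ℝ} (hR : 0 < R)
    (hc : ContinuousOn f (Ioc 0 R)) (h : ∀ r ∈ Ioo 0 R, HasDerivAt f (f1 r) r)
    (hpos : ∀ᶠ r in 𝓝[<] R, 0 < f1 r) : ∀ᶠ r in 𝓝[<] R, f r < f R := by
  obtain ⟨d, hd0, hd⟩ := mem_nhdsLT_iff_exists_Ioo_subset.1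
    (inter_mem hpos (Ioo_mem_nhdsLT hR))
  filter_upwards [Ioo_mem_nhdsLT hd0] with r hr
  have hr0 : 0 < r := (hd hr).2.1
  refine strictMonoOn_of_deriv_pos (convex_Icc r R)
    (hc.mono fun x hx => ⟨hr0.trans_le hx.1, hx.2⟩) ?_ ⟨le_rfl, hr.2.le⟩ ⟨hr.2.le, le_rfl⟩ hr.2
  intro x hx
  rw [interior_Icc] at hx
  have hx' : x ∈ Ioo d R := ⟨hr.1.trans hx.1, hx.2⟩
  rw [(h x (hd hx').2).deriv]
  exact (hd hx').1

/-- Boundary point lemma for a function attaining its maximum at the outer endpoint, where its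
second derivative is positive. -/
theorem deriv_pos_of_le_of_deriv2_pos {f f1 f2 : ℝ → ℝ} {R : ℝ} (hR : 0 < R)
    (h1 : ∀ r ∈ Ioc 0 R, HasDerivWithinAt f (f1 r) (Ioc 0 R) r)
    (h2 : ∀ r ∈ Ioc 0 R, HasDerivWithinAt f1 (f2 r) (Ioc 0 R) r)
    (hle : ∀ r ∈ Ioc 0 R, f r ≤ f R) (hpos : f1 R = 0 → 0 < f2 R) : 0 < f1 R := by
  have hRm : R ∈ Ioc 0 R := ⟨hR, le_rfl⟩
  have hmem : ∀ᶠ r in 𝓝[<] R, r ∈ Ioo 0 R := Ioo_mem_nhdsLT hR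
  have hderiv : ∀ r ∈ Ioo 0 R, HasDerivAt f (f1 r) r := fun r hr =>
    (h1 r (Ioo_subset_Ioc_self hr)).hasDerivAt (Ioc_mem_nhds hr.1 hr.2)
  by_contra! hneg
  have key : ∀ᶠ r in 𝓝[<] R, -f r < -f R := by
    rcases hneg.lt_or_eq with h | h
    · exact eventually_lt_of_hasDerivWithinAt_pos (f := fun r => -f r) hR (h1 R hRm).neg
        (by linarith)
    · refine eventually_lt_of_eventually_deriv_pos (f := fun r => -f r) (f1 := fun r => -f1 r) hR
        (fun r hr => (h1 r hr).neg.continuousWithinAt) (fun r hr => (hderiv r hr).neg) ?_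
      filter_upwards [eventually_lt_of_hasDerivWithinAt_pos hR (h2 R hRm) (hpos h)] with r hr
      linarith
  obtain ⟨r, hr, hr'⟩ := (key.and hmem).exists
  have := hle r (Ioo_subset_Ioc_self hr')
  linarith

/-- Boundary point lemma for a function attaining its minimum at the outer endpoint, where its
radial Laplacian vanishes to first order. -/
theorem deriv_neg_of_ge_of_laplacian_deriv_pos {f f1 f2 G : ℝ → ℝ} {R d : ℝ} (hR : 0 < R)
    (h1 : ∀ r ∈ Ioc 0 R, HasDerivWithinAt f (f1 r) (Ioc 0 R) r)
    (h2 : ∀ r ∈ Ioc 0 R, HasDerivWithinAt f1 (f2 r) (Ioc 0 R) r)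
    (hG : ∀ r ∈ Ioc 0 R, f2 r + f1 r / r = G r)
    (hge : ∀ r ∈ Ioc 0 R, f R ≤ f r) (hG0 : G R = 0)
    (hGd : f1 R = 0 → HasDerivWithinAt G d (Ioc 0 R) R) (hpos : 0 < d) : f1 R < 0 := by
  have hRm : R ∈ Ioc 0 R := ⟨hR, le_rfl⟩
  have hmem : ∀ᶠ r in 𝓝[<] R, r ∈ Ioo 0 R := Ioo_mem_nhdsLT hR
  have hderiv : ∀ r ∈ Ioo 0 R, HasDerivAt f (f1 r) r := fun r hr =>
    (h1 r (Ioo_subset_Ioc_self hr)).hasDerivAt (Ioc_mem_nhds hr.1 hr.2)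
  have hderiv2 : ∀ r ∈ Ioo 0 R, HasDerivAt f1 (f2 r) r := fun r hr =>
    (h2 r (Ioo_subset_Ioc_self hr)).hasDerivAt (Ioc_mem_nhds hr.1 hr.2)
  by_contra! hnn
  have key : ∀ᶠ r in 𝓝[<] R, f r < f R := by
    rcases hnn.lt_or_eq with h | h
    · exact eventually_lt_of_hasDerivWithinAt_pos hR (h1 R hRm) h
    · refine eventually_lt_of_eventually_deriv_pos hR
        (fun r hr => (h1 r hr).continuousWithinAt) hderiv ?_
      have hP := eventually_lt_of_eventually_deriv_pos (f := fun r => -(r * f1 r))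
        (f1 := fun r => -(r * G r)) hR
        (fun r hr => (continuousWithinAt_id.mul (h2 r hr).continuousWithinAt).neg)
        (fun r hr => (hasDerivAt_mul_radial hr.1 (hderiv2 r hr)
          (hG r (Ioo_subset_Ioc_self hr))).neg) (by
          filter_upwards [eventually_lt_of_hasDerivWithinAt_pos hR (hGd h.symm) hpos, hmem]
            with r hr hr'
          rw [hG0] at hr
          have := mul_pos_of_neg_of_neg hr (neg_neg_of_pos hr'.1)
          linarith)
      filter_upwards [hP, hmem] with r hr hr'
      rw [← h] at hr
      exact pos_of_mul_pos_right (by linarith : 0 < r * f1 r) hr'.1.le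
  obtain ⟨r, hr, hr'⟩ := (key.and hmem).exists
  have := hge r (Ioo_subset_Ioc_self hr')
  linarith

theorem potential_radial_pos {a B c t p q : ℝ} (hB : 0 < B) (hc : 0 < c) (ht : 0 < t)
    (ha : 0 ≤ a) (hat : a = 4 * c * t ^ 2 - 2 * B * t) (h : 4 * t ^ 2 < p ^ 2 + q ^ 2) :
    0 < p * (p * (-a + 2 * B * q + c * (p ^ 2 + q ^ 2)))
      + q * (q * (-a - B * q + c * (p ^ 2 + q ^ 2)) + B * p ^ 2) := by
  set x := √(p ^ 2 + q ^ 2) with hx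
  have hx2 : x ^ 2 = p ^ 2 + q ^ 2 := Real.sq_sqrt (by positivity)
  have hx0 : 0 ≤ x := Real.sqrt_nonneg _
  have hxt : 2 * t < x := by nlinarith
  have hcub : -x ^ 3 ≤ 3 * p ^ 2 * q - q ^ 3 := by
    have : (3 * p ^ 2 * q - q ^ 3) ^ 2 ≤ (x ^ 3) ^ 2 := by
      have e : (x ^ 3) ^ 2 = (p ^ 2 + q ^ 2) ^ 3 := by rw [← hx2]; ring
      rw [e]
      nlinarith [sq_nonneg (p * (p ^ 2 - 3 * q ^ 2))]
    exact (abs_le.1 (abs_le_of_sq_le_sq this (by positivity))).1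
  have hBt : B ≤ 2 * c * t := by
    by_contra! hh
    nlinarith
  have h2 : 0 < x ^ 2 * ((x - 2 * t) * (c * x + 2 * c * t - B)) := by
    have : 0 < c * x + 2 * c * t - B := by nlinarith
    have : 0 < x := by linarith
    have : 0 < x - 2 * t := by linarith
    positivity
  have h3 := mul_le_mul_of_nonneg_left hcub hB.le
  have e1 : p * (p * (-a + 2 * B * q + c * (p ^ 2 + q ^ 2)))
      + q * (q * (-a - B * q + c * (p ^ 2 + q ^ 2)) + B * p ^ 2)
      = x ^ 2 * (-a + c * x ^ 2) + B * (3 * p ^ 2 * q - q ^ 3) := by rw [hx2]; ring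
  rw [e1]
  subst hat
  nlinarith

theorem potential_deriv_snd_pos {a B c t p q : ℝ} (hB : 0 < B) (hc : 0 < c) (ht : 0 < t)
    (hat : a = 4 * c * t ^ 2 - 2 * B * t) (hBt : B < c * t) (hq : -t < q) (hq0 : q < 0)
    (hp : p ^ 2 ≤ 3 * t ^ 2) :
    0 < q * (-a - B * q + c * (p ^ 2 + q ^ 2)) + B * p ^ 2 := by
  have e : q * (-a - B * q + c * (p ^ 2 + q ^ 2)) + B * p ^ 2
      = q * (-a - B * q + c * q ^ 2) + p ^ 2 * (c * q + B) := by ring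
  rw [e]
  rcases le_or_gt 0 (c * q + B) with h | h
  · have h1 : 0 ≤ p ^ 2 * (c * q + B) := by positivity
    have h2 : 0 < a + B * q - c * q ^ 2 := by
      have h3 : (-q) * (c * (-q)) ≤ (-q) * B := mul_le_mul_of_nonneg_left (by linarith) (by linarith)
      nlinarith [mul_lt_mul_of_pos_left hBt ht, mul_lt_mul_of_pos_left hBt (neg_pos.2 hq0), mul_pos hB ht]
    nlinarith [mul_pos (neg_pos.2 hq0) h2]
  · have h1 : 3 * t ^ 2 * (c * q + B) ≤ p ^ 2 * (c * q + B) :=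
      mul_le_mul_of_nonpos_right hp h.le
    have h2 : 0 < (q + t) * (c * q ^ 2 - (B + c * t) * q + 3 * B * t) := by
      have : 0 < q + t := by linarith
      have : 0 < (B + c * t) * (-q) := mul_pos (by positivity) (by linarith)
      have : 0 < c * q ^ 2 - (B + c * t) * q + 3 * B * t := by
        have : 0 ≤ c * q ^ 2 := by positivity
        have : 0 < B * t := by positivity
        nlinarith
      positivity
    subst hat
    nlinarith

theorem potential_deriv_snd_neg {a B c t p q : ℝ} (hB : 0 < B) (ht : 0 < t)
    (hat : a = 4 * c * t ^ 2 - 2 * B * t) (hBt : c * t < B) (hq : q < -t)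
    (hp : p ^ 2 + q ^ 2 ≤ 4 * t ^ 2) :
    q * (-a - B * q + c * (p ^ 2 + q ^ 2)) + B * p ^ 2 < 0 := by
  have e : q * (-a - B * q + c * (p ^ 2 + q ^ 2)) + B * p ^ 2
      = q * (-a - B * q + c * q ^ 2) + p ^ 2 * (c * q + B) := by ring
  rw [e]
  rcases le_or_gt 0 (c * q + B) with h | h
  · have h1 : p ^ 2 * (c * q + B) ≤ (4 * t ^ 2 - q ^ 2) * (c * q + B) :=
      mul_le_mul_of_nonneg_right (by linarith) h
    have h2 : 0 < 2 * B * ((2 * t - q) * (-t - q)) := by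
      have : 0 < 2 * t - q := by linarith
      have : 0 < -t - q := by linarith
      positivity
    subst hat
    nlinarith
  · have h1 : p ^ 2 * (c * q + B) ≤ 0 := mul_nonpos_of_nonneg_of_nonpos (sq_nonneg p) h.le
    have h2 : 0 < -a - B * q + c * q ^ 2 := by
      have h3 : (-q) * B ≤ (-q) * (c * (-q)) := mul_le_mul_of_nonneg_left (by linarith) (by linarith)
      nlinarith [mul_lt_mul_of_pos_left hBt ht, mul_pos hB ht, mul_pos hB (by linarith : 0 < -q - t)]
    nlinarith [mul_pos (by linarith : 0 < -q) h2]

theorem potential_deriv_fst_nonneg {a B c t q P : ℝ} (hc : 0 < c)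
    (hat : a = 4 * c * t ^ 2 - 2 * B * t) (hBt : c * t < B) (hq : -t ≤ q)
    (hP : 3 * t ^ 2 ≤ P) : 0 ≤ -a + 2 * B * q + c * (P + q ^ 2) := by
  have h1 : 0 ≤ (q + t) * (2 * B + c * (q - t)) :=
    mul_nonneg (by linarith) (by nlinarith)
  have h2 := mul_le_mul_of_nonneg_left hP hc.le
  subst hat
  nlinarith

/-- The radial profile system on `(0, R]` with explicit derivatives, in the normalisation
`B = b² / √6`, `c = c²`, `t = s₊ / √6` and `κ = k²`. -/
structure RadialProfile (a B c t κ R : ℝ) (u v u1 v1 u2 v2 : ℝ → ℝ) : Prop where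
  R_pos : 0 < R
  B_pos : 0 < B
  c_pos : 0 < c
  t_pos : 0 < t
  κ_pos : 0 < κ
  a_nonneg : 0 ≤ a
  a_eq : a = 4 * c * t ^ 2 - 2 * B * t
  deriv_u : ∀ r ∈ Ioc 0 R, HasDerivWithinAt u (u1 r) (Ioc 0 R) r
  deriv_v : ∀ r ∈ Ioc 0 R, HasDerivWithinAt v (v1 r) (Ioc 0 R) r
  deriv_u1 : ∀ r ∈ Ioc 0 R, HasDerivWithinAt u1 (u2 r) (Ioc 0 R) r
  deriv_v1 : ∀ r ∈ Ioc 0 R, HasDerivWithinAt v1 (v2 r) (Ioc 0 R) r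
  ode_u : ∀ r ∈ Ioc 0 R, u2 r + u1 r / r - κ / r ^ 2 * u r
    = u r * (-a + 2 * B * v r + c * (u r ^ 2 + v r ^ 2))
  ode_v : ∀ r ∈ Ioc 0 R, v2 r + v1 r / r
    = v r * (-a - B * v r + c * (u r ^ 2 + v r ^ 2)) + B * u r ^ 2
  u_zero : Tendsto u (𝓝[>] 0) (𝓝 0)
  v1_zero : Tendsto v1 (𝓝[>] 0) (𝓝 0)
  u_end : u R = √3 * t
  v_end : v R = -t
  u_pos : ∀ r ∈ Ioo 0 R, 0 < u r
  v_neg : ∀ r ∈ Ioo 0 R, v r < 0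

namespace RadialProfile

variable {a B c t κ R : ℝ} {u v u1 v1 u2 v2 : ℝ → ℝ}

theorem interior (S : RadialProfile a B c t κ R u v u1 v1 u2 v2) {r : ℝ} (hr : r ∈ Ioo 0 R) :
    HasDerivAt u (u1 r) r ∧ HasDerivAt v (v1 r) r ∧
      HasDerivAt u1 (u2 r) r ∧ HasDerivAt v1 (v2 r) r := by
  have hr' := Ioo_subset_Ioc_self hr
  have hn : Ioc 0 R ∈ 𝓝 r := Ioc_mem_nhds hr.1 hr.2
  exact ⟨(S.deriv_u r hr').hasDerivAt hn, (S.deriv_v r hr').hasDerivAt hn,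
    (S.deriv_u1 r hr').hasDerivAt hn, (S.deriv_v1 r hr').hasDerivAt hn⟩

theorem eventually_mem (S : RadialProfile a B c t κ R u v u1 v1 u2 v2) :
    ∀ᶠ r in 𝓝[>] 0, r ∈ Ioo 0 R := Ioo_mem_nhdsGT S.R_pos

theorem continuousOn_u (S : RadialProfile a B c t κ R u v u1 v1 u2 v2) :
    ContinuousOn u (Ioc 0 R) := fun r hr => (S.deriv_u r hr).continuousWithinAt

theorem continuousOn_v (S : RadialProfile a B c t κ R u v u1 v1 u2 v2) :
    ContinuousOn v (Ioc 0 R) := fun r hr => (S.deriv_v r hr).continuousWithinAt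

theorem end_sq (S : RadialProfile a B c t κ R u v u1 v1 u2 v2) : u R ^ 2 = 3 * t ^ 2 := by
  rw [S.u_end, mul_pow, Real.sq_sqrt (by norm_num)]

theorem exists_v_zero (S : RadialProfile a B c t κ R u v u1 v1 u2 v2) :
    ∃ l ≤ 0, Tendsto v (𝓝[>] 0) (𝓝 l) := by
  obtain ⟨l, hl⟩ := exists_tendsto_nhdsGT_of_tendsto_deriv S.R_pos
    (fun r hr => (S.interior hr).2.1) S.v1_zero
  exact ⟨l, le_of_tendsto hl (S.eventually_mem.mono fun r hr => (S.v_neg r hr).le), hl⟩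

theorem eventually_gt_v (S : RadialProfile a B c t κ R u v u1 v1 u2 v2) {l : ℝ}
    (hl : Tendsto v (𝓝[>] 0) (𝓝 l))
    (h : ∀ᶠ r in 𝓝[>] 0, 0 < v r * (-a - B * v r + c * (u r ^ 2 + v r ^ 2)) + B * u r ^ 2) :
    ∀ᶠ r in 𝓝[>] 0, l < v r :=
  eventually_gt_of_radial_laplacian_pos S.R_pos (fun _ hr => (S.interior hr).2.1)
    (fun _ hr => (S.interior hr).2.2.2) (fun r hr => S.ode_v r (Ioo_subset_Ioc_self hr))
    hl S.v1_zero h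

theorem eventually_lt_v (S : RadialProfile a B c t κ R u v u1 v1 u2 v2) {l : ℝ}
    (hl : Tendsto v (𝓝[>] 0) (𝓝 l))
    (h : ∀ᶠ r in 𝓝[>] 0, v r * (-a - B * v r + c * (u r ^ 2 + v r ^ 2)) + B * u r ^ 2 < 0) :
    ∀ᶠ r in 𝓝[>] 0, v r < l := by
  have := eventually_gt_of_radial_laplacian_pos (f := fun r => -v r) (f1 := fun r => -v1 r)
    (f2 := fun r => -v2 r)
    (G := fun r => -(v r * (-a - B * v r + c * (u r ^ 2 + v r ^ 2)) + B * u r ^ 2))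
    S.R_pos (fun r hr => (S.interior hr).2.1.neg)
    (fun r hr => (S.interior hr).2.2.2.neg)
    (fun r hr => by rw [← S.ode_v r (Ioo_subset_Ioc_self hr)]; ring)
    hl.neg (by simpa using S.v1_zero.neg) (h.mono fun r hr => neg_pos.2 hr)
  exact this.mono fun r hr => neg_lt_neg_iff.1 hr

theorem sq_add_sq_le (S : RadialProfile a B c t κ R u v u1 v1 u2 v2) :
    ∀ r ∈ Ioc 0 R, u r ^ 2 + v r ^ 2 ≤ 4 * t ^ 2 := by
  obtain ⟨l, hl0, hl⟩ := S.exists_v_zero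
  have hB := S.B_pos
  have hc := S.c_pos
  have ht := S.t_pos
  have hlim : Tendsto (fun r => u r ^ 2 + v r ^ 2) (𝓝[>] 0) (𝓝 (l ^ 2)) := by
    simpa using (S.u_zero.pow 2).add (hl.pow 2)
  refine le_of_not_isLocalMax ((S.continuousOn_u.pow 2).add (S.continuousOn_v.pow 2)) hlim
    (by rw [S.end_sq, S.v_end]; linarith) ?_ ?_
  · intro h
    have hneg : l * (-a - B * l + c * (0 ^ 2 + l ^ 2)) + B * 0 ^ 2 < 0 := by
      have h1 : 2 * t < -l := by nlinarith
      have h2 : 0 < -a - B * l + c * l ^ 2 := by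
        have := mul_lt_mul_of_pos_left h hc
        have := mul_pos hB (by linarith : 0 < -l - 2 * t)
        have := mul_pos hB ht
        rw [S.a_eq]
        nlinarith
      have := mul_neg_of_neg_of_pos (by linarith : l < 0) h2
      linarith
    have hT : Tendsto (fun r => v r * (-a - B * v r + c * (u r ^ 2 + v r ^ 2)) + B * u r ^ 2)
        (𝓝[>] 0) (𝓝 (l * (-a - B * l + c * (0 ^ 2 + l ^ 2)) + B * 0 ^ 2)) :=
      (hl.mul ((tendsto_const_nhds.sub (hl.const_mul B)).add
        (((S.u_zero.pow 2).add (hl.pow 2)).const_mul c))).add ((S.u_zero.pow 2).const_mul B)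
    obtain ⟨r, hr, hr'⟩ := ((S.eventually_lt_v hl (hT.eventually_lt_const hneg)).and
      S.eventually_mem).exists
    exact ⟨r, hr', by nlinarith [sq_nonneg (u r)]⟩
  · intro r hr hM
    obtain ⟨hu, hv, hu1, hv1⟩ := S.interior hr
    have hr' := Ioo_subset_Ioc_self hr
    refine not_isLocalMax_of_deriv2_pos (f1 := fun y => 2 * (u y * u1 y + v y * v1 y))
      (f2 := 2 * (u1 r * u1 r + u r * u2 r + (v1 r * v1 r + v r * v2 r))) ?_ ?_ ?_
    · filter_upwards [Ioo_mem_nhds hr.1 hr.2] with y hy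
      obtain ⟨hu, hv, -, -⟩ := S.interior hy
      refine ((hu.pow 2).add (hv.pow 2)).congr_deriv ?_
      simp
      ring
    · exact ((hu.mul hu1).add (hv.mul hv1)).const_mul 2
    · intro h0
      have h1 := potential_radial_pos hB hc ht S.a_nonneg S.a_eq hM
      rw [← S.ode_v r hr', ← S.ode_u r hr'] at h1
      have h2 : 0 ≤ κ / r ^ 2 * u r ^ 2 :=
        mul_nonneg (div_nonneg S.κ_pos.le (sq_nonneg r)) (sq_nonneg _)
      have h3 : (u r * u1 r + v r * v1 r) / r = 0 := by
        rw [show u r * u1 r + v r * v1 r = 0 by linarith, zero_div]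
      have h4 : u r * (u2 r + u1 r / r - κ / r ^ 2 * u r) + v r * (v2 r + v1 r / r)
        = u r * u2 r + v r * v2 r + (u r * u1 r + v r * v1 r) / r - κ / r ^ 2 * u r ^ 2 := by ring
      nlinarith [mul_self_nonneg (u1 r), mul_self_nonneg (v1 r)]

theorem le_sqrt_three_mul_neg (S : RadialProfile a B c t κ R u v u1 v1 u2 v2)
    (hBt : B < c * t) : ∀ r ∈ Ioc 0 R, u r / (-v r) ≤ √3 := by
  obtain ⟨l, hl0, hl⟩ := S.exists_v_zero
  have ht := S.t_pos
  have hl0 : l < 0 := by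
    refine lt_of_le_of_ne hl0 ?_
    rintro rfl
    have hu2 : Tendsto (fun r => u r ^ 2) (𝓝[>] 0) (𝓝 0) := by simpa using S.u_zero.pow 2
    have := S.eventually_gt_v hl (by
      filter_upwards [S.eventually_mem, hl.eventually_const_lt (neg_lt_zero.2 ht),
        hu2.eventually_lt_const (by positivity : 0 < 3 * t ^ 2)] with r hr h1 h2
      exact potential_deriv_snd_pos S.B_pos S.c_pos ht S.a_eq hBt h1 (S.v_neg r hr) h2.le)
    obtain ⟨r, hr, hr'⟩ := (this.and S.eventually_mem).exists
    exact lt_asymm hr (S.v_neg r hr')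
  have hvneg : ∀ r ∈ Ioc 0 R, v r < 0 := by
    intro r hr
    rcases hr.2.lt_or_eq with h | h
    · exact S.v_neg r ⟨hr.1, h⟩
    · rw [h, S.v_end]; linarith
  have hlim : Tendsto (fun r => u r / (-v r)) (𝓝[>] 0) (𝓝 0) := by
    have := S.u_zero.div hl.neg (neg_ne_zero.2 hl0.ne)
    rwa [zero_div] at this
  refine le_of_not_isLocalMax
    (S.continuousOn_u.div S.continuousOn_v.neg fun r hr => by linarith [hvneg r hr]) hlim
    ?_ ?_ ?_
  · rw [S.u_end, S.v_end, neg_neg, mul_div_cancel_right₀ _ ht.ne']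
  · intro h
    exact absurd h (not_lt.2 (Real.sqrt_nonneg 3))
  · intro r hr hM hmax
    set σ := u r / (-v r) with hσ
    have hr' := Ioo_subset_Ioc_self hr
    have hv0 := S.v_neg r hr
    have hur : u r = -σ * v r := by
      rw [hσ]
      field_simp [hv0.ne]
    have hσ3 : 3 < σ ^ 2 := (Real.sqrt_lt' ((Real.sqrt_nonneg 3).trans_lt hM)).1 hM
    have hmax' : IsLocalMax (fun y => u y + σ * v y) r := by
      filter_upwards [hmax, Ioo_mem_nhds hr.1 hr.2] with y hy hy'
      have hvy := S.v_neg y hy'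
      have hy : u y / (-v y) ≤ σ := hy
      rw [div_le_iff₀ (by linarith)] at hy
      simp only [hur]
      linarith
    obtain ⟨hu, hv, hu1, hv1⟩ := S.interior hr
    refine not_isLocalMax_of_deriv2_pos (f1 := fun y => u1 y + σ * v1 y)
      (f2 := u2 r + σ * v2 r) ?_ (hu1.add (hv1.const_mul σ)) ?_ hmax'
    · filter_upwards [Ioo_mem_nhds hr.1 hr.2] with y hy
      exact (S.interior hy).1.add ((S.interior hy).2.1.const_mul σ)
    · intro h0
      have h1 : 0 < κ / r ^ 2 * u r :=
        mul_pos (div_pos S.κ_pos (pow_pos hr.1 2)) (S.u_pos r hr)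
      have h2 : 0 < B * σ * (v r ^ 2 * (σ ^ 2 - 3)) :=
        mul_pos (mul_pos S.B_pos ((Real.sqrt_nonneg 3).trans_lt hM))
          (mul_pos (sq_pos_of_neg hv0) (by linarith))
      have h3 : u1 r / r + σ * (v1 r / r) = 0 := by
        rw [show u1 r / r + σ * (v1 r / r) = (u1 r + σ * v1 r) / r by ring, h0, zero_div]
      have e1 := S.ode_u r hr'
      have e2 := S.ode_v r hr'
      have e3 : u r * (-a + 2 * B * v r + c * (u r ^ 2 + v r ^ 2))
          + σ * (v r * (-a - B * v r + c * (u r ^ 2 + v r ^ 2)) + B * u r ^ 2)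
          = B * σ * (v r ^ 2 * (σ ^ 2 - 3)) := by rw [hur]; ring
      rw [← e1, ← e2] at e3
      linarith

theorem v_le (S : RadialProfile a B c t κ R u v u1 v1 u2 v2) (hBt : B < c * t) :
    ∀ r ∈ Ioc 0 R, v r ≤ -t := by
  obtain ⟨l, hl0, hl⟩ := S.exists_v_zero
  have key : ∀ r ∈ Ioo 0 R, -t < v r →
      0 < v r * (-a - B * v r + c * (u r ^ 2 + v r ^ 2)) + B * u r ^ 2 := by
    intro r hr h
    refine potential_deriv_snd_pos S.B_pos S.c_pos S.t_pos S.a_eq hBt h (S.v_neg r hr) ?_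
    have h1 := S.le_sqrt_three_mul_neg hBt r (Ioo_subset_Ioc_self hr)
    have hv := S.v_neg r hr
    rw [div_le_iff₀ (by linarith)] at h1
    have h2 : u r ^ 2 ≤ (√3 * -v r) ^ 2 := pow_le_pow_left₀ (S.u_pos r hr).le h1 2
    rw [mul_pow, Real.sq_sqrt (by norm_num)] at h2
    nlinarith
  refine le_of_not_isLocalMax S.continuousOn_v hl S.v_end.le ?_ ?_
  · intro h
    obtain ⟨r, hr, hr'⟩ := ((S.eventually_gt_v hl (by
      filter_upwards [S.eventually_mem, hl.eventually_const_lt h] using key)).and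
        S.eventually_mem).exists
    exact ⟨r, hr', hr⟩
  · intro r hr hM
    obtain ⟨hu, hv, hu1, hv1⟩ := S.interior hr
    refine not_isLocalMax_of_deriv2_pos ?_ hv1 ?_
    · filter_upwards [Ioo_mem_nhds hr.1 hr.2] with y hy using (S.interior hy).2.1
    · intro h0
      have := key r hr hM
      rw [← S.ode_v r (Ioo_subset_Ioc_self hr), h0, zero_div] at this
      linarith

theorem le_v (S : RadialProfile a B c t κ R u v u1 v1 u2 v2) (hBt : c * t < B) :
    ∀ r ∈ Ioc 0 R, -v r ≤ t := by
  obtain ⟨l, hl0, hl⟩ := S.exists_v_zero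
  have key : ∀ r ∈ Ioo 0 R, t < -v r →
      v r * (-a - B * v r + c * (u r ^ 2 + v r ^ 2)) + B * u r ^ 2 < 0 := fun r hr h =>
    potential_deriv_snd_neg S.B_pos S.t_pos S.a_eq hBt (by linarith)
      (S.sq_add_sq_le r (Ioo_subset_Ioc_self hr))
  refine le_of_not_isLocalMax S.continuousOn_v.neg hl.neg (by rw [S.v_end, neg_neg]) ?_ ?_
  · intro h
    obtain ⟨r, hr, hr'⟩ := ((S.eventually_lt_v hl (by
      filter_upwards [S.eventually_mem, hl.neg.eventually_const_lt h] using key)).and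
        S.eventually_mem).exists
    exact ⟨r, hr', neg_lt_neg hr⟩
  · intro r hr hM
    obtain ⟨hu, hv, hu1, hv1⟩ := S.interior hr
    refine not_isLocalMax_of_deriv2_pos (f1 := fun y => -v1 y) ?_ hv1.neg ?_
    · filter_upwards [Ioo_mem_nhds hr.1 hr.2] with y hy using (S.interior hy).2.1.neg
    · intro h0
      have := key r hr hM
      rw [← S.ode_v r (Ioo_subset_Ioc_self hr), neg_eq_zero.1 h0, zero_div] at this
      linarith

theorem u_le_of_lt (S : RadialProfile a B c t κ R u v u1 v1 u2 v2) (hBt : B < c * t) :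
    ∀ r ∈ Ioc 0 R, u r ≤ √3 * t := by
  intro r hr
  have h1 := S.v_le hBt r hr
  have h2 := S.sq_add_sq_le r hr
  have ht := S.t_pos
  refine (abs_le.1 (abs_le_of_sq_le_sq ?_ (by positivity))).2
  rw [mul_pow, Real.sq_sqrt (by norm_num)]
  nlinarith

theorem u_le_of_gt (S : RadialProfile a B c t κ R u v u1 v1 u2 v2) (hBt : c * t < B) :
    ∀ r ∈ Ioc 0 R, u r ≤ √3 * t := by
  have ht := S.t_pos
  have hst : 0 ≤ √3 * t := by positivity
  refine le_of_not_isLocalMax S.continuousOn_u S.u_zero S.u_end.le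
    (fun h => absurd h (not_lt.2 hst)) ?_
  intro r hr hM
  have hr' := Ioo_subset_Ioc_self hr
  obtain ⟨hu, hv, hu1, hv1⟩ := S.interior hr
  refine not_isLocalMax_of_deriv2_pos ?_ hu1 ?_
  · filter_upwards [Ioo_mem_nhds hr.1 hr.2] with y hy using (S.interior hy).1
  · intro h0
    have h1 : 0 < κ / r ^ 2 * u r :=
      mul_pos (div_pos S.κ_pos (pow_pos hr.1 2)) (S.u_pos r hr)
    have h2 : 3 * t ^ 2 ≤ u r ^ 2 := by
      have := pow_le_pow_left₀ hst hM.le 2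
      rwa [mul_pow, Real.sq_sqrt (by norm_num)] at this
    have h3 := mul_nonneg (S.u_pos r hr).le (potential_deriv_fst_nonneg S.c_pos S.a_eq hBt
      (by linarith [S.le_v hBt r hr'] : -t ≤ v r) h2)
    have h4 := S.ode_u r hr'
    rw [h0, zero_div] at h4
    linarith

theorem deriv_u_end_pos (S : RadialProfile a B c t κ R u v u1 v1 u2 v2)
    (h : ∀ r ∈ Ioc 0 R, u r ≤ √3 * t) : 0 < u1 R := by
  have hRm : R ∈ Ioc 0 R := ⟨S.R_pos, le_rfl⟩
  refine deriv_pos_of_le_of_deriv2_pos S.R_pos S.deriv_u S.deriv_u1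
    (fun r hr => (h r hr).trans_eq S.u_end.symm) ?_
  intro h0
  have h1 := S.ode_u R hRm
  rw [S.end_sq, S.v_end, h0, zero_div, S.a_eq, S.u_end] at h1
  have ht := S.t_pos
  have : 0 < κ / R ^ 2 * (√3 * t) :=
    mul_pos (div_pos S.κ_pos (pow_pos S.R_pos 2)) (by positivity)
  nlinarith

theorem laplacian_v_end (S : RadialProfile a B c t κ R u v u1 v1 u2 v2) :
    v R * (-a - B * v R + c * (u R ^ 2 + v R ^ 2)) + B * u R ^ 2 = 0 := by
  rw [S.end_sq, S.v_end, S.a_eq]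
  ring

theorem hasDerivWithinAt_laplacian_v_end (S : RadialProfile a B c t κ R u v u1 v1 u2 v2)
    (h0 : v1 R = 0) :
    HasDerivWithinAt (fun r => v r * (-a - B * v r + c * (u r ^ 2 + v r ^ 2)) + B * u r ^ 2)
      (2 * √3 * t * (B - c * t) * u1 R) (Ioc 0 R) R := by
  have hRm : R ∈ Ioc 0 R := ⟨S.R_pos, le_rfl⟩
  have hu := S.deriv_u R hRm
  have hv := S.deriv_v R hRm
  refine ((hv.mul (((hv.const_mul B).const_sub (-a)).add
    (((hu.pow 2).add (hv.pow 2)).const_mul c))).add ((hu.pow 2).const_mul B)).congr_deriv ?_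
  simp [h0, S.u_end, S.v_end]
  ring

theorem deriv_v_end_pos (S : RadialProfile a B c t κ R u v u1 v1 u2 v2) (hBt : B < c * t) :
    0 < v1 R := by
  have ht := S.t_pos
  have hu := S.deriv_u_end_pos (S.u_le_of_lt hBt)
  refine neg_neg_iff_pos.1 (deriv_neg_of_ge_of_laplacian_deriv_pos (f := fun r => -v r) (f1 := fun r => -v1 r)
    (f2 := fun r => -v2 r)
    (G := fun r => -(v r * (-a - B * v r + c * (u r ^ 2 + v r ^ 2)) + B * u r ^ 2))
    S.R_pos (fun r hr => (S.deriv_v r hr).neg) (fun r hr => (S.deriv_v1 r hr).neg)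
    (fun r hr => by rw [← S.ode_v r hr]; ring)
    (fun r hr => by rw [S.v_end]; linarith [S.v_le hBt r hr])
    (by rw [S.laplacian_v_end, neg_zero])
    (fun h => (S.hasDerivWithinAt_laplacian_v_end (neg_eq_zero.1 h)).neg) ?_)
  have : 0 < 2 * √3 * t * (c * t - B) * u1 R :=
    mul_pos (mul_pos (by positivity) (by linarith)) hu
  linarith

theorem deriv_v_end_neg (S : RadialProfile a B c t κ R u v u1 v1 u2 v2) (hBt : c * t < B) :
    v1 R < 0 := by
  have ht := S.t_pos
  have hu := S.deriv_u_end_pos (S.u_le_of_gt hBt)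
  refine deriv_neg_of_ge_of_laplacian_deriv_pos S.R_pos S.deriv_v S.deriv_v1 S.ode_v
    (fun r hr => by rw [S.v_end]; linarith [S.le_v hBt r hr]) S.laplacian_v_end
    S.hasDerivWithinAt_laplacian_v_end ?_
  exact mul_pos (mul_pos (by positivity) (by linarith)) hu

end RadialProfile

theorem iset_ofReal {R : ℝ} (hR : 0 < R) : Iset (ENNReal.ofReal R) = Ioo 0 R := by
  ext r
  simp [Iset, ENNReal.ofReal_lt_ofReal_iff hR]

theorem endFilter_ofReal {R : ℝ} (hR : 0 < R) : endFilter (ENNReal.ofReal R) = 𝓝[<] R := by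
  simp [endFilter, ENNReal.toReal_ofReal hR.le]

theorem ContDiffOn.hasDerivWithinAt_Ioc {f : ℝ → ℝ} {R : ℝ}
    (hf : ContDiffOn ℝ 2 f (Ioc 0 R)) :
    (∀ r ∈ Ioc 0 R, HasDerivWithinAt f (derivWithin f (Ioc 0 R) r) (Ioc 0 R) r) ∧
    (∀ r ∈ Ioc 0 R, HasDerivWithinAt (derivWithin f (Ioc 0 R))
      (derivWithin (derivWithin f (Ioc 0 R)) (Ioc 0 R) r) (Ioc 0 R) r) ∧
    ContinuousOn (derivWithin (derivWithin f (Ioc 0 R)) (Ioc 0 R)) (Ioc 0 R) := by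
  have h1 : ContDiffOn ℝ 1 (derivWithin f (Ioc 0 R)) (Ioc 0 R) :=
    hf.derivWithin (uniqueDiffOn_Ioc 0 R) (by norm_num)
  have h2 : ContDiffOn ℝ 0 (derivWithin (derivWithin f (Ioc 0 R)) (Ioc 0 R)) (Ioc 0 R) :=
    h1.derivWithin (uniqueDiffOn_Ioc 0 R) (by norm_num)
  exact ⟨fun r hr => (hf.differentiableOn (by norm_num) r hr).hasDerivWithinAt,
    fun r hr => (h1.differentiableOn (by norm_num) r hr).hasDerivWithinAt, h2.continuousOn⟩

theorem derivWithin_Ioc_eq_deriv (f : ℝ → ℝ) {R r : ℝ} (hr : r ∈ Ioo 0 R) :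
    derivWithin f (Ioc 0 R) r = deriv f r :=
  derivWithin_of_mem_nhds (Ioc_mem_nhds hr.1 hr.2)

theorem derivWithin_derivWithin_Ioc_eq_deriv (f : ℝ → ℝ) {R r : ℝ} (hr : r ∈ Ioo 0 R) :
    derivWithin (derivWithin f (Ioc 0 R)) (Ioc 0 R) r = deriv (deriv f) r := by
  rw [derivWithin_Ioc_eq_deriv _ hr]
  refine Filter.EventuallyEq.deriv_eq ?_
  filter_upwards [Ioo_mem_nhds hr.1 hr.2] with y hy using derivWithin_Ioc_eq_deriv f hy

theorem ContinuousOn.eq_of_eqOn_Ioo {f g : ℝ → ℝ} {R : ℝ} (hR : 0 < R)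
    (hf : ContinuousOn f (Ioc 0 R)) (hg : ContinuousOn g (Ioc 0 R))
    (h : ∀ r ∈ Ioo 0 R, f r = g r) : ∀ r ∈ Ioc 0 R, f r = g r := by
  have hle : 𝓝[<] R ≤ 𝓝[Ioc 0 R] R :=
    nhdsWithin_le_of_mem (mem_of_superset (Ioo_mem_nhdsLT hR) Ioo_subset_Ioc_self)
  intro r hr
  rcases hr.2.lt_or_eq with h' | rfl
  · exact h r ⟨hr.1, h'⟩
  · refine tendsto_nhds_unique_of_eventuallyEq ((hf r hr).tendsto.mono_left hle)
      ((hg r hr).tendsto.mono_left hle) ?_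
    filter_upwards [Ioo_mem_nhdsLT hR] using h

theorem sPlus_pos {a2 b2 c2 : ℝ} (hb : 0 < b2) (hc : 0 < c2) : 0 < sPlus a2 b2 c2 :=
  div_pos (add_pos_of_pos_of_nonneg hb (Real.sqrt_nonneg _)) (by linarith)

theorem sPlus_root {a2 b2 c2 : ℝ} (ha : 0 ≤ a2) (hc : 0 < c2) :
    3 * a2 = 2 * c2 * sPlus a2 b2 c2 ^ 2 - b2 * sPlus a2 b2 c2 := by
  have h := Real.sq_sqrt (by positivity : 0 ≤ b2 ^ 2 + 24 * a2 * c2)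
  rw [sPlus]
  set D := √(b2 ^ 2 + 24 * a2 * c2)
  field_simp
  linear_combination -2 * h

theorem four_mul_mul_sPlus {a2 b2 c2 : ℝ} (hc : 0 < c2) :
    4 * (c2 * sPlus a2 b2 c2) = b2 + √(b2 ^ 2 + 24 * a2 * c2) := by
  rw [sPlus]
  field_simp

theorem ProfileSolution.radialProfile {a2 b2 c2 R : ℝ} (ha : 0 ≤ a2) (hb : 0 < b2) (hc : 0 < c2)
    {k : ℤ} (hk : k ≠ 0) (hR : 0 < R) {u v : ℝ → ℝ}
    (hsol : ProfileSolution a2 b2 c2 k (ENNReal.ofReal R) u v)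
    (hC2u : ContDiffOn ℝ 2 u (Set.Ioc 0 R)) (hC2v : ContDiffOn ℝ 2 v (Set.Ioc 0 R))
    (hu : ∀ r ∈ Set.Ioo 0 R, 0 < u r) (hv : ∀ r ∈ Set.Ioo 0 R, v r < 0) :
    RadialProfile a2 (b2 / √6) c2 (sPlus a2 b2 c2 / √6) ((k : ℝ) ^ 2) R u v
      (derivWithin u (Ioc 0 R)) (derivWithin v (Ioc 0 R))
      (derivWithin (derivWithin u (Ioc 0 R)) (Ioc 0 R))
      (derivWithin (derivWithin v (Ioc 0 R)) (Ioc 0 R)) := by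
  obtain ⟨hu1, hu2, hu2c⟩ := hC2u.hasDerivWithinAt_Ioc
  obtain ⟨hv1, hv2, hv2c⟩ := hC2v.hasDerivWithinAt_Ioc
  have huc := hC2u.continuousOn
  have hvc := hC2v.continuousOn
  have hu1c : ContinuousOn (derivWithin u (Ioc 0 R)) (Ioc 0 R) :=
    fun r hr => (hu2 r hr).continuousWithinAt
  have hv1c : ContinuousOn (derivWithin v (Ioc 0 R)) (Ioc 0 R) :=
    fun r hr => (hv2 r hr).continuousWithinAt
  have hne : ∀ r ∈ Ioc 0 R, r ≠ 0 := fun r hr => hr.1.ne'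
  have hne2 : ∀ r ∈ Ioc 0 R, r ^ 2 ≠ 0 := fun r hr => pow_ne_zero 2 (hne r hr)
  have hRm : R ∈ Ioc 0 R := ⟨hR, le_rfl⟩
  have hle : 𝓝[<] R ≤ 𝓝[Ioc 0 R] R :=
    nhdsWithin_le_of_mem (mem_of_superset (Ioo_mem_nhdsLT hR) Ioo_subset_Ioc_self)
  have hs := sPlus_pos (a2 := a2) hb hc
  have h6 : √6 = √2 * √3 := by rw [← Real.sqrt_mul (by norm_num)]; norm_num
  have hbu := hsol.bcR_u
  have hbv := hsol.bcR_v
  rw [endFilter_ofReal hR] at hbu hbv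
  refine
    { R_pos := hR
      B_pos := by positivity
      c_pos := hc
      t_pos := by positivity
      κ_pos := by positivity
      a_nonneg := ha
      a_eq := ?_
      deriv_u := hu1
      deriv_v := hv1
      deriv_u1 := hu2
      deriv_v1 := hv2
      ode_u := ?_
      ode_v := ?_
      u_zero := hsol.bc0_u
      v1_zero := ?_
      u_end := ?_
      v_end := tendsto_nhds_unique ((hvc R hRm).tendsto.mono_left hle) hbv
      u_pos := hu
      v_neg := hv }
  · have h := sPlus_root (b2 := b2) ha hc
    have h66 : √6 ^ 2 = 6 := Real.sq_sqrt (by norm_num)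
    field_simp
    rw [h66]
    linarith
  · refine ContinuousOn.eq_of_eqOn_Ioo hR (by fun_prop (disch := assumption))
      (by fun_prop (disch := assumption)) ?_
    intro r hr
    have h := hsol.ode_u r (by rwa [iset_ofReal hR])
    rw [derivWithin_derivWithin_Ioc_eq_deriv u hr, derivWithin_Ioc_eq_deriv u hr, h, hfun]
    ring
  · refine ContinuousOn.eq_of_eqOn_Ioo hR (by fun_prop (disch := assumption))
      (by fun_prop (disch := assumption)) ?_
    intro r hr
    have h := hsol.ode_v r (by rwa [iset_ofReal hR])
    rw [derivWithin_derivWithin_Ioc_eq_deriv v hr, derivWithin_Ioc_eq_deriv v hr, h, gfun]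
  · refine hsol.bc0_v.congr' ?_
    filter_upwards [Ioo_mem_nhdsGT hR] with r hr using (derivWithin_Ioc_eq_deriv v hr).symm
  · rw [tendsto_nhds_unique ((huc R hRm).tendsto.mono_left hle) hbu, h6]
    field_simp

/-- **Hopf-type boundary derivative estimates** at a finite right endpoint `R`: for a
profile solution extending to a C² pair on `(0,R]` with `u > 0` and `v < 0` on `(0,R)`,
one has `u'(R) > 0` always, while `v'(R) > 0` if `b⁴ < 3a²c²` and `v'(R) < 0` if
`b⁴ > 3a²c²`. -/
theorem stmt9 (a2 b2 c2 : ℝ) (ha : 0 ≤ a2) (hb : 0 < b2) (hc : 0 < c2)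
    (k : ℤ) (hk : k ≠ 0) (R : ℝ) (hR : 0 < R)
    (u v : ℝ → ℝ)
    (hsol : ProfileSolution a2 b2 c2 k (ENNReal.ofReal R) u v)
    (hC2u : ContDiffOn ℝ 2 u (Set.Ioc 0 R)) (hC2v : ContDiffOn ℝ 2 v (Set.Ioc 0 R))
    (hu : ∀ r ∈ Set.Ioo 0 R, 0 < u r) (hv : ∀ r ∈ Set.Ioo 0 R, v r < 0) :
    (b2 ^ 2 < 3 * a2 * c2 →
      0 < derivWithin u (Set.Ioc 0 R) R ∧ 0 < derivWithin v (Set.Ioc 0 R) R) ∧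
    (3 * a2 * c2 < b2 ^ 2 →
      0 < derivWithin u (Set.Ioc 0 R) R ∧ derivWithin v (Set.Ioc 0 R) R < 0) := by
  have S := hsol.radialProfile ha hb hc hk hR hC2u hC2v hu hv
  have hs := four_mul_mul_sPlus (a2 := a2) (b2 := b2) hc
  have h6 : 0 < √6 := by positivity
  refine ⟨fun h => ?_, fun h => ?_⟩
  · have hD : 3 * b2 < √(b2 ^ 2 + 24 * a2 * c2) :=
      Real.lt_sqrt_of_sq_lt (by nlinarith)
    have hBt : b2 / √6 < c2 * (sPlus a2 b2 c2 / √6) := by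
      rw [← mul_div_assoc]
      exact div_lt_div_of_pos_right (by linarith) h6
    exact ⟨S.deriv_u_end_pos (S.u_le_of_lt hBt), S.deriv_v_end_pos hBt⟩
  · have hD : √(b2 ^ 2 + 24 * a2 * c2) < 3 * b2 :=
      (Real.sqrt_lt' (by linarith)).2 (by nlinarith)
    have hBt : c2 * (sPlus a2 b2 c2 / √6) < b2 / √6 := by
      rw [← mul_div_assoc]
      exact div_lt_div_of_pos_right (by linarith) h6
    exact ⟨S.deriv_u_end_pos (S.u_le_of_gt hBt), S.deriv_v_end_neg hBt⟩


end
end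

section
/- Strauss-type decay estimate at infinity: There exists a constant C > 0 such that for every continuously differentiable function w : (0,∞) → ℝ with ∫_{1/2}^∞ (w'(s)² + w(s)²) s ds < ∞ and every r ∈ (1/2, ∞), one has w(r)² ≤ (C/r)·∫_{1/2}^∞ (w'(s)² + w(s)²) s ds. In particular w(r) → 0 as r → ∞. -/
open Real MeasureTheory Filter Set Topology
open scoped ENNReal

noncomputable section

/-- A one-dimensional Sobolev bound on the unit interval to the right of `r`. -/
theorem sq_le_two_mul_intervalIntegral {w : ℝ → ℝ} {r : ℝ}
    (hw : ∀ s ∈ Set.Icc r (r + 1), DifferentiableAt ℝ w s)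
    (hw' : ContinuousOn (deriv w) (Set.Icc r (r + 1))) :
    w r ^ 2 ≤ 2 * ∫ s in r..r + 1, (deriv w s ^ 2 + w s ^ 2) := by
  have hle : r ≤ r + 1 := by linarith
  have hc : ContinuousOn w (Set.Icc r (r + 1)) := fun s hs =>
    (hw s hs).continuousAt.continuousWithinAt
  have hderiv : ∀ s ∈ Set.uIcc r (r + 1), HasDerivAt (fun s => (s - (r + 1)) * w s ^ 2)
      (w s ^ 2 + (s - (r + 1)) * (2 * w s * deriv w s)) s := by
    intro s hs
    rw [Set.uIcc_of_le hle] at hs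
    have h := ((hasDerivAt_id s).sub_const (r + 1)).mul ((hw s hs).hasDerivAt.pow 2)
    refine h.congr_deriv ?_
    simp
  have hint : IntervalIntegrable (fun s => w s ^ 2 + (s - (r + 1)) * (2 * w s * deriv w s))
      volume r (r + 1) := by
    apply ContinuousOn.intervalIntegrable_of_Icc hle
    fun_prop
  have hint' : IntervalIntegrable (fun s => 2 * (deriv w s ^ 2 + w s ^ 2)) volume r (r + 1) := by
    apply ContinuousOn.intervalIntegrable_of_Icc hle
    fun_prop
  have hftc := intervalIntegral.integral_eq_sub_of_hasDerivAt hderiv hint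
  have hmono := intervalIntegral.integral_mono_on hle hint hint' fun s hs => by
    have h0 : 0 ≤ r + 1 - s := by linarith [hs.2]
    have h1 : 0 ≤ 1 - (r + 1 - s) := by linarith [hs.1]
    nlinarith [mul_nonneg h0 (sq_nonneg (w s + deriv w s)),
      mul_nonneg h1 (add_nonneg (sq_nonneg (w s)) (sq_nonneg (deriv w s))), sq_nonneg (deriv w s)]
  rw [hftc, intervalIntegral.integral_const_mul] at hmono
  linarith

/-- **Strauss-type decay estimate at infinity**: there is `C > 0` such that every C¹
function `w` on `(0,∞)` with `∫_{1/2}^∞ (w'² + w²) s ds < ∞` satisfies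
`w(r)² ≤ (C/r) ∫_{1/2}^∞ (w'² + w²) s ds` for `r > 1/2`, and `w(r) → 0` as `r → ∞`. -/
theorem stmt10 : ∃ C : ℝ, 0 < C ∧ ∀ w : ℝ → ℝ, ContDiffOn ℝ 1 w (Set.Ioi 0) →
    IntegrableOn (fun s => (deriv w s ^ 2 + w s ^ 2) * s) (Set.Ioi (1/2 : ℝ)) →
    (∀ r ∈ Set.Ioi (1/2 : ℝ),
      w r ^ 2 ≤ C / r * ∫ s in Set.Ioi (1/2 : ℝ), (deriv w s ^ 2 + w s ^ 2) * s) ∧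
    Filter.Tendsto w Filter.atTop (nhds 0) := by
  refine ⟨2, two_pos, fun w hw hint => ?_⟩
  have hbound : ∀ r ∈ Set.Ioi (1/2 : ℝ),
      w r ^ 2 ≤ 2 / r * ∫ s in Set.Ioi (1/2 : ℝ), (deriv w s ^ 2 + w s ^ 2) * s := by
    intro r hr
    have hr' : (1/2 : ℝ) < r := hr
    have hr0 : 0 < r := by linarith
    have hle : r ≤ r + 1 := by linarith
    have hsub : Set.Icc r (r + 1) ⊆ Set.Ioi 0 := fun s hs => hr0.trans_le hs.1
    have hsub' : Set.Ioc r (r + 1) ⊆ Set.Ioi (1/2 : ℝ) := fun s hs => hr'.trans hs.1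
    have hd : ∀ s ∈ Set.Icc r (r + 1), DifferentiableAt ℝ w s := fun s hs =>
      (hw.differentiableOn one_ne_zero).differentiableAt (Ioi_mem_nhds (hsub hs))
    have hc : ContinuousOn w (Set.Icc r (r + 1)) := hw.continuousOn.mono hsub
    have hc' : ContinuousOn (deriv w) (Set.Icc r (r + 1)) :=
      (hw.continuousOn_deriv_of_isOpen isOpen_Ioi le_rfl).mono hsub
    have hlocal : r * ∫ s in r..r + 1, (deriv w s ^ 2 + w s ^ 2) ≤
        ∫ s in r..r + 1, (deriv w s ^ 2 + w s ^ 2) * s := by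
      rw [← intervalIntegral.integral_const_mul]
      refine intervalIntegral.integral_mono_on hle
        (ContinuousOn.intervalIntegrable_of_Icc hle (by fun_prop))
        (ContinuousOn.intervalIntegrable_of_Icc hle (by fun_prop)) fun s hs => ?_
      rw [mul_comm]
      exact mul_le_mul_of_nonneg_left hs.1 (by positivity)
    have hglobal : ∫ s in r..r + 1, (deriv w s ^ 2 + w s ^ 2) * s ≤
        ∫ s in Set.Ioi (1/2 : ℝ), (deriv w s ^ 2 + w s ^ 2) * s := by
      rw [intervalIntegral.integral_of_le hle]
      refine setIntegral_mono_set hint ?_ hsub'.eventuallyLE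
      filter_upwards [ae_restrict_mem measurableSet_Ioi] with s hs
      have hs0 : (0 : ℝ) ≤ s := by linarith [Set.mem_Ioi.mp hs]
      exact mul_nonneg (by positivity) hs0
    have hsob := sq_le_two_mul_intervalIntegral hd hc'
    rw [div_mul_eq_mul_div, le_div_iff₀ hr0]
    nlinarith
  refine ⟨hbound, ?_⟩
  have hsq : Tendsto (fun r => w r ^ 2) atTop (nhds 0) := by
    refine squeeze_zero' (Eventually.of_forall fun r => sq_nonneg (w r))
      ((eventually_gt_atTop (1/2 : ℝ)).mono hbound) ?_
    simpa using (tendsto_const_nhds.div_atTop tendsto_id).mul_const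
      (∫ s in Set.Ioi (1/2 : ℝ), (deriv w s ^ 2 + w s ^ 2) * s)
  rw [tendsto_zero_iff_abs_tendsto_zero]
  simpa [Function.comp_def, Real.sqrt_sq_eq_abs] using hsq.sqrt

end
end

section
/- Pointwise control via the Hardy weight: There exists a constant C > 0 such that for every continuously differentiable function w : (0,∞) → ℝ with ∫₀^1 (w'(s)² + w(s)²/s²) s ds < ∞, one has w(r) → 0 as r → 0⁺, and for every r ∈ (0,∞) with ∫₀^r (w'(s)² + w(s)²/s²) s ds < ∞, one has w(r)² ≤ C·∫₀^r (w'(s)² + w(s)²/s²) s ds. -/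
open Real MeasureTheory Filter Set Topology
open scoped ENNReal

noncomputable section

/-- If `u s / s` is dominated by an integrable function on `(0, r)`, then `u` takes values
below any `ε > 0`, since `1 / s` is not integrable near `0`. -/
lemma exists_le_of_integrableOn_of_div_le {f u : ℝ → ℝ} {r ε : ℝ} (hr : 0 < r) (hε : 0 < ε)
    (hf : IntegrableOn f (Ioo 0 r)) (hu : ∀ s ∈ Ioo 0 r, u s / s ≤ f s) :
    ∃ a ∈ Ioo 0 r, u a ≤ ε := by
  by_contra! h
  have hint : IntegrableOn (fun s : ℝ => s⁻¹) (Ioo 0 r) := by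
    refine Integrable.mono' (hf.const_mul ε⁻¹) measurable_inv.aestronglyMeasurable ?_
    refine (ae_restrict_iff' measurableSet_Ioo).2 (ae_of_all _ fun s hs => ?_)
    have hs0 : 0 < s := hs.1
    rw [Real.norm_of_nonneg (inv_nonneg.2 hs0.le), ← div_eq_inv_mul, le_div_iff₀ hε]
    refine le_trans ?_ (hu s hs)
    rw [div_eq_inv_mul]
    exact mul_le_mul_of_nonneg_left (h s hs).le (inv_nonneg.2 hs0.le)
  have hii : IntervalIntegrable (fun s : ℝ => s⁻¹) volume 0 r :=
    (intervalIntegrable_iff_integrableOn_Ioo_of_le hr.le).2 hint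
  rcases intervalIntegrable_inv_iff.1 hii with h0 | h0
  · exact hr.ne h0
  · exact h0 left_mem_uIcc

/-- A `C¹` function with finite Hardy energy on `(0, r)` satisfies
`w r ^ 2 ≤ ∫₀^r (w' ^ 2 + w ^ 2 / s ^ 2) s ds`. -/
lemma sq_le_integral_hardy {w : ℝ → ℝ} (hw : ContDiffOn ℝ 1 w (Ioi 0)) {r : ℝ} (hr : 0 < r)
    (hf : IntegrableOn (fun s => (deriv w s ^ 2 + w s ^ 2 / s ^ 2) * s) (Ioo 0 r)) :
    w r ^ 2 ≤ ∫ s in Ioo (0:ℝ) r, (deriv w s ^ 2 + w s ^ 2 / s ^ 2) * s := by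
  refine le_of_forall_pos_le_add fun ε hε => ?_
  obtain ⟨a, ⟨ha0, har⟩, ha⟩ := exists_le_of_integrableOn_of_div_le (u := fun s => w s ^ 2)
    hr hε hf fun s hs => by
      have hs0 : 0 < s := hs.1
      have : w s ^ 2 / s = w s ^ 2 / s ^ 2 * s := by field_simp
      rw [this]
      gcongr
      exact le_add_of_nonneg_left (sq_nonneg _)
  have hderiv : ∀ x, 0 < x → HasDerivAt w (deriv w x) x := fun x hx =>
    ((hw.differentiableOn one_ne_zero).differentiableAt (Ioi_mem_nhds hx)).hasDerivAt
  have hIcc : IntegrableOn (fun s => (deriv w s ^ 2 + w s ^ 2 / s ^ 2) * s) (Icc a r) :=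
    ((integrableOn_Icc_iff_integrableOn_Ioo).2 hf).mono_set (Icc_subset_Icc_left ha0.le)
  have hsub : w r ^ 2 - w a ^ 2 ≤ ∫ s in a..r, (deriv w s ^ 2 + w s ^ 2 / s ^ 2) * s := by
    refine intervalIntegral.sub_le_integral_of_hasDeriv_right_of_le (g := fun s => w s ^ 2)
      (g' := fun s => 2 * w s * deriv w s) har.le ?_ ?_ hIcc ?_
    · exact (hw.continuousOn.mono fun x hx => ha0.trans_le hx.1).pow 2
    · intro x hx
      simpa using ((hderiv x (ha0.trans hx.1)).fun_pow 2).hasDerivWithinAt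
    · intro x hx
      have hx0 : 0 < x := ha0.trans hx.1
      have : (deriv w x ^ 2 + w x ^ 2 / x ^ 2) * x - 2 * w x * deriv w x
          = (deriv w x - w x / x) ^ 2 * x := by field_simp; ring
      have : 0 ≤ (deriv w x - w x / x) ^ 2 * x := by positivity
      linarith
  have hmono : ∫ s in a..r, (deriv w s ^ 2 + w s ^ 2 / s ^ 2) * s
      ≤ ∫ s in Ioo (0:ℝ) r, (deriv w s ^ 2 + w s ^ 2 / s ^ 2) * s := by
    rw [intervalIntegral.integral_of_le har.le, integral_Ioc_eq_integral_Ioo]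
    refine setIntegral_mono_set hf ?_ (Ioo_subset_Ioo_left ha0.le).eventuallyLE
    refine (ae_restrict_iff' measurableSet_Ioo).2 (ae_of_all _ fun s hs => ?_)
    have hs0 : 0 < s := hs.1
    simp only [Pi.zero_apply]
    positivity
  linarith

/-- **Pointwise control via the Hardy weight**: there is `C > 0` such that for every C¹
function `w` on `(0,∞)`: if `∫₀^1 (w'² + w²/s²) s ds < ∞` then `w(r) → 0` as `r → 0⁺`; and
for every `r > 0` with `∫₀^r (w'² + w²/s²) s ds < ∞`,
`w(r)² ≤ C ∫₀^r (w'² + w²/s²) s ds`. -/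
theorem stmt11 : ∃ C : ℝ, 0 < C ∧ ∀ w : ℝ → ℝ, ContDiffOn ℝ 1 w (Set.Ioi 0) →
    (IntegrableOn (fun s => (deriv w s ^ 2 + w s ^ 2 / s ^ 2) * s) (Set.Ioo 0 1) →
      Filter.Tendsto w (nhdsWithin 0 (Set.Ioi 0)) (nhds 0)) ∧
    (∀ r : ℝ, 0 < r →
      IntegrableOn (fun s => (deriv w s ^ 2 + w s ^ 2 / s ^ 2) * s) (Set.Ioo 0 r) →
      w r ^ 2 ≤ C * ∫ s in Set.Ioo (0:ℝ) r, (deriv w s ^ 2 + w s ^ 2 / s ^ 2) * s) := by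
  refine ⟨1, one_pos, fun w hw => ⟨fun hf => ?_, fun r hr hf => ?_⟩⟩
  · have hlim : Tendsto (fun r => ∫ s in Ioc (0:ℝ) r, (deriv w s ^ 2 + w s ^ 2 / s ^ 2) * s)
        (𝓝[>] 0) (𝓝 0) := by
      have h := intervalIntegral.continuousOn_primitive
        ((integrableOn_Icc_iff_integrableOn_Ioo).2 hf) 0 (left_mem_Icc.2 zero_le_one)
      have h' := h.tendsto
      rw [Ioc_self, Measure.restrict_empty, integral_zero_measure] at h'
      exact h'.mono_left (nhdsWithin_le_of_mem (Icc_mem_nhdsGT zero_lt_one))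
    have hsq : Tendsto (fun r => w r ^ 2) (𝓝[>] 0) (𝓝 0) := by
      refine squeeze_zero' (Eventually.of_forall fun r => sq_nonneg _) ?_ hlim
      filter_upwards [Ioo_mem_nhdsGT (zero_lt_one (α := ℝ))] with r hr
      rw [integral_Ioc_eq_integral_Ioo]
      exact sq_le_integral_hardy hw hr.1 (hf.mono_set (Ioo_subset_Ioo_right hr.2.le))
    rw [tendsto_zero_iff_abs_tendsto_zero]
    simpa [Function.comp_def, Real.sqrt_sq_eq_abs] using hsq.sqrt
  · rw [one_mul]
    exact sq_le_integral_hardy hw hr hf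

end
end

section
/- Logarithmic bound near the origin: There exists a constant C > 0 such that for every continuously differentiable function w : (0,∞) → ℝ with ∫₀^∞ (w'(s)² + w(s)²) s ds < ∞ and every r ∈ (0, 1/2), one has w(r)² ≤ C·|log r|·∫₀^∞ (w'(s)² + w(s)²) s ds. -/
open Real MeasureTheory Filter Set Topology
open scoped ENNReal

noncomputable section

/-- The weighted Cauchy–Schwarz bound: for `0 < a ≤ b`,
`(w b - w a)² ≤ L ∫ₐᵇ (w')² s ds` whenever `L > 0` and `log (b / a) ≤ L`. -/
theorem sq_sub_le_mul_integral_deriv_sq_mul {w : ℝ → ℝ} (hw : ContDiffOn ℝ 1 w (Ioi 0))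
    {a b L : ℝ} (ha : 0 < a) (hab : a ≤ b) (hL : 0 < L) (hlog : Real.log (b / a) ≤ L) :
    (w b - w a) ^ 2 ≤ L * ∫ s in a..b, deriv w s ^ 2 * s := by
  have hsub : uIcc a b ⊆ Ioi 0 := by
    rw [uIcc_of_le hab]; exact fun x hx => ha.trans_le hx.1
  have hd : ContinuousOn (deriv w) (uIcc a b) :=
    (hw.continuousOn_deriv_of_isOpen isOpen_Ioi le_rfl).mono hsub
  have hftc : ∫ s in a..b, deriv w s = w b - w a :=
    intervalIntegral.integral_deriv_eq_sub
      (fun x hx => (hw.differentiableOn one_ne_zero).differentiableAt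
        (isOpen_Ioi.mem_nhds (hsub hx))) hd.intervalIntegrable
  have hinv : ContinuousOn (fun s : ℝ => s⁻¹) (uIcc a b) :=
    continuousOn_id.inv₀ fun x hx => (hsub hx).ne'
  have hsq : ContinuousOn (fun s => deriv w s ^ 2 * s) (uIcc a b) :=
    (hd.pow 2).mul continuousOn_id
  set c := (w b - w a) / L with hc
  have hmono : ∫ s in a..b, 2 * c * deriv w s ≤
      ∫ s in a..b, (deriv w s ^ 2 * s + c ^ 2 * s⁻¹) := by
    refine intervalIntegral.integral_mono_on hab
      (hd.intervalIntegrable.const_mul _)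
      (hsq.intervalIntegrable.add (hinv.intervalIntegrable.const_mul _)) fun s hs => ?_
    have hs0 : 0 < s := ha.trans_le hs.1
    have h : deriv w s ^ 2 * s + c ^ 2 * s⁻¹ - 2 * c * deriv w s =
        (deriv w s * s - c) ^ 2 * s⁻¹ := by
      field_simp
      ring
    have : 0 ≤ (deriv w s * s - c) ^ 2 * s⁻¹ := by positivity
    linarith
  rw [intervalIntegral.integral_add hsq.intervalIntegrable
      (hinv.intervalIntegrable.const_mul _), intervalIntegral.integral_const_mul,
    intervalIntegral.integral_const_mul, hftc,
    integral_inv_of_pos ha (ha.trans_le hab)] at hmono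
  have hcL : w b - w a = c * L := by rw [hc]; field_simp
  rw [hcL] at hmono ⊢
  have h1 : c ^ 2 * Real.log (b / a) ≤ c ^ 2 * L := by gcongr
  have h2 : c ^ 2 * L ≤ ∫ s in a..b, deriv w s ^ 2 * s := by linarith
  nlinarith

/-- A continuous function on `[1/2, 1]` satisfies `w(t)² ≤ 4 ∫ w² s ds` at some point `t`. -/
theorem exists_sq_le_four_mul_integral {w : ℝ → ℝ} (hw : ContinuousOn w (Icc (1 / 2) 1)) :
    ∃ t ∈ Icc (1 / 2 : ℝ) 1, w t ^ 2 ≤ 4 * ∫ s in (1 / 2 : ℝ)..1, w s ^ 2 * s := by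
  have hle : (1 / 2 : ℝ) ≤ 1 := by norm_num
  obtain ⟨t, ht, hmin⟩ := isCompact_Icc.exists_isMinOn (nonempty_Icc.2 hle) (hw.pow 2)
  refine ⟨t, ht, ?_⟩
  have hcont : ContinuousOn (fun s => w s ^ 2 * s) (uIcc (1 / 2) 1) := by
    rw [uIcc_of_le hle]; exact (hw.pow 2).mul continuousOn_id
  have h : ∫ _ in (1 / 2 : ℝ)..1, w t ^ 2 * (1 / 2) ≤ ∫ s in (1 / 2 : ℝ)..1, w s ^ 2 * s :=
    intervalIntegral.integral_mono_on hle intervalIntegrable_const hcont.intervalIntegrable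
      fun s hs => mul_le_mul (hmin hs) hs.1 (by norm_num) (sq_nonneg _)
  rw [intervalIntegral.integral_const, smul_eq_mul] at h
  linarith

/-- The integral over `[a, b] ⊆ (0, ∞)` of a continuous function dominated by an integrable `g`
is at most the integral of `g` over `(0, ∞)`. -/
theorem intervalIntegral_le_integral_Ioi {f g : ℝ → ℝ} {a b : ℝ} (ha : 0 < a) (hab : a ≤ b)
    (hf : ContinuousOn f (Ioi 0)) (hg : IntegrableOn g (Ioi 0))
    (hg0 : ∀ s, 0 < s → 0 ≤ g s) (hfg : ∀ s, 0 < s → f s ≤ g s) :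
    ∫ s in a..b, f s ≤ ∫ s in Ioi 0, g s := by
  have hsub : Ioc a b ⊆ Ioi 0 := fun x hx => ha.trans hx.1
  have hfi : IntegrableOn f (Ioc a b) :=
    ((hf.mono fun x hx => ha.trans_le hx.1).integrableOn_Icc).mono_set Ioc_subset_Icc_self
  rw [intervalIntegral.integral_of_le hab]
  calc ∫ s in Ioc a b, f s ≤ ∫ s in Ioc a b, g s :=
        setIntegral_mono_on hfi (hg.mono_set hsub) measurableSet_Ioc
          fun s hs => hfg s (hsub hs)
    _ ≤ ∫ s in Ioi 0, g s :=
        setIntegral_mono_set hg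
          ((ae_restrict_iff' measurableSet_Ioi).2 (.of_forall fun s hs => hg0 s hs))
          (.of_forall hsub)

/-- **Logarithmic bound near the origin**: there is `C > 0` such that every C¹ function `w`
on `(0,∞)` with `∫₀^∞ (w'² + w²) s ds < ∞` satisfies, for `0 < r < 1/2`,
`w(r)² ≤ C |log r| ∫₀^∞ (w'² + w²) s ds`. -/
theorem stmt12 : ∃ C : ℝ, 0 < C ∧ ∀ w : ℝ → ℝ, ContDiffOn ℝ 1 w (Set.Ioi 0) →
    IntegrableOn (fun s => (deriv w s ^ 2 + w s ^ 2) * s) (Set.Ioi (0:ℝ)) →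
    ∀ r ∈ Set.Ioo (0:ℝ) (1/2 : ℝ),
      w r ^ 2 ≤ C * |Real.log r| *
        ∫ s in Set.Ioi (0:ℝ), (deriv w s ^ 2 + w s ^ 2) * s := by
  refine ⟨18, by norm_num, fun w hw hint r hr => ?_⟩
  obtain ⟨hr0, hr1⟩ := hr
  have hpos : ∀ s : ℝ, 0 < s → 0 ≤ (deriv w s ^ 2 + w s ^ 2) * s := fun s hs => by positivity
  have hd := hw.continuousOn_deriv_of_isOpen isOpen_Ioi le_rfl
  obtain ⟨t, ⟨ht1, ht2⟩, ht⟩ := exists_sq_le_four_mul_integral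
    (hw.continuousOn.mono fun x hx => lt_of_lt_of_le (by norm_num) hx.1)
  have hL : 1 / 2 ≤ |Real.log r| := by
    have h1 : Real.log r ≤ Real.log (1 / 2) := Real.log_le_log hr0 hr1.le
    have h2 : Real.log (1 / 2) = -Real.log 2 := by rw [one_div, Real.log_inv]
    have h3 := Real.log_two_gt_d9
    have h4 := neg_le_abs (Real.log r)
    linarith
  have hlog : Real.log (t / r) ≤ |Real.log r| := by
    rw [Real.log_div (by linarith) hr0.ne']
    have h1 : Real.log t ≤ 0 := Real.log_nonpos (by linarith) ht2
    have h2 := neg_le_abs (Real.log r)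
    linarith
  have hdiff := sq_sub_le_mul_integral_deriv_sq_mul hw hr0 (by linarith : r ≤ t)
    (by linarith) hlog
  have hE1 := intervalIntegral_le_integral_Ioi (f := fun s => deriv w s ^ 2 * s) hr0
    (by linarith : r ≤ t) ((hd.pow 2).mul continuousOn_id) hint hpos
    fun s hs => by gcongr; exact le_add_of_nonneg_right (sq_nonneg _)
  have hE2 := intervalIntegral_le_integral_Ioi (f := fun s => w s ^ 2 * s)
    (by norm_num : (0 : ℝ) < 1 / 2) (by norm_num : (1 / 2 : ℝ) ≤ 1)
    ((hw.continuousOn.pow 2).mul continuousOn_id) hint hpos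
    fun s hs => by gcongr; exact le_add_of_nonneg_left (sq_nonneg _)
  have hE0 := setIntegral_nonneg (μ := volume) measurableSet_Ioi hpos
  set E := ∫ s in Set.Ioi (0:ℝ), (deriv w s ^ 2 + w s ^ 2) * s
  have hdE : (w t - w r) ^ 2 ≤ |Real.log r| * E := hdiff.trans (by gcongr)
  have hLE : 1 / 2 * E ≤ |Real.log r| * E := by gcongr
  linarith [sq_nonneg (2 * w t - w r)]

end
end

section
/- Quadratic coercivity of the bulk potential on the quadrant: Assume a² ≥ 0 and b², c² > 0, and define f(x,y) = −(a²/2)(x² + y²) + (c²/4)(x² + y²)² − (b²/(3√6))·y·(y² − 3x²). Then there exists a constant α > 0 such that for all x ≥ 0 and y ≤ 0: f(x,y) − f(s₊/√2, −s₊/√6) ≥ α·((x − s₊/√2)² + (y + s₊/√6)²). -/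
open Real MeasureTheory Filter Set Topology
open scoped ENNReal

noncomputable section

/-- The bulk potential `f(x,y) = −(a²/2)(x²+y²) + (c²/4)(x²+y²)² − (b²/(3√6)) y (y² − 3x²)`. -/
def fbulk (a2 b2 c2 x y : ℝ) : ℝ :=
  -(a2 / 2) * (x ^ 2 + y ^ 2) + c2 / 4 * (x ^ 2 + y ^ 2) ^ 2
    - b2 / (3 * Real.sqrt 6) * (y * (y ^ 2 - 3 * x ^ 2))

theorem sPlus_quadratic {a2 b2 c2 : ℝ} (ha : 0 ≤ a2) (hc : 0 < c2) :
    2 * c2 * sPlus a2 b2 c2 ^ 2 = b2 * sPlus a2 b2 c2 + 3 * a2 := by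
  have hr : Real.sqrt (b2 ^ 2 + 24 * a2 * c2) ^ 2 = b2 ^ 2 + 24 * a2 * c2 :=
    Real.sq_sqrt (by positivity)
  unfold sPlus
  generalize Real.sqrt (b2 ^ 2 + 24 * a2 * c2) = r at hr ⊢
  field_simp
  linear_combination 2 * hr

theorem fbulk_rescaled (a2 b2 c2 p q : ℝ) :
    fbulk a2 b2 c2 (p / Real.sqrt 2) (-(q / Real.sqrt 6)) =
      -(a2 / 12) * (3 * p ^ 2 + q ^ 2) + c2 / 144 * (3 * p ^ 2 + q ^ 2) ^ 2
        - b2 / 108 * (q * (9 * p ^ 2 - q ^ 2)) := by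
  have h2 : Real.sqrt 2 ^ 2 = 2 := Real.sq_sqrt (by norm_num)
  have h6 : Real.sqrt 6 ^ 2 = 6 := Real.sq_sqrt (by norm_num)
  have hx : (p / Real.sqrt 2) ^ 2 = p ^ 2 / 2 := by rw [div_pow, h2]
  have hy : (-(q / Real.sqrt 6)) ^ 2 = q ^ 2 / 6 := by rw [neg_sq, div_pow, h6]
  have hcub : b2 / (3 * Real.sqrt 6) * -(q / Real.sqrt 6) = -(b2 * q / 18) := by
    rw [mul_neg, div_mul_div_comm, mul_assoc, ← sq, h6]
    norm_num
  unfold fbulk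
  rw [← mul_assoc, hx, hy, hcub]
  ring

theorem quartic_coercive {s p q : ℝ} (hs : 0 < s) (hp : 0 ≤ p) (hq : 0 ≤ q) :
    s ^ 2 * (3 * (p - s) ^ 2 + (q - s) ^ 2) ≤
      3 * (3 * p ^ 2 + q ^ 2 - 4 * q * s) ^ 2 + 16 * s * (q - s) ^ 2 * (2 * q + s) := by
  set A := 3 * p ^ 2 + q ^ 2 - 4 * q * s with hA
  have hlin : s ^ 2 * (q - s) ^ 2 ≤ s * (q - s) ^ 2 * (2 * q + s) := by
    have : 0 ≤ s * (q - s) ^ 2 * q := by positivity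
    nlinarith
  rcases le_total q (4 * s) with h | h
  · have h1 : s ^ 2 * (3 * (p - s) ^ 2) ≤ 3 * ((p + s) * (p - s)) ^ 2 := by
      have : s ^ 2 ≤ (p + s) ^ 2 := by gcongr; linarith
      nlinarith [mul_le_mul_of_nonneg_right this (sq_nonneg (p - s))]
    have h2 : 3 * ((p + s) * (p - s)) = A - (q - s) * (q - 3 * s) := by rw [hA]; ring
    have h3 : 3 * (3 * ((p + s) * (p - s)) ^ 2) ≤ 2 * A ^ 2 + 2 * ((q - s) * (q - 3 * s)) ^ 2 := by
      have := sq_nonneg (A + (q - s) * (q - 3 * s))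
      nlinarith [congrArg (· ^ 2) h2]
    have h4 : ((q - s) * (q - 3 * s)) ^ 2 ≤ 9 * (s ^ 2 * (q - s) ^ 2) := by
      have : (q - 3 * s) ^ 2 ≤ 9 * s ^ 2 := by nlinarith [sq_nonneg s, mul_nonneg hq hs.le]
      nlinarith [mul_le_mul_of_nonneg_right this (sq_nonneg (q - s))]
    nlinarith [sq_nonneg A, mul_nonneg (sq_nonneg s) (sq_nonneg (q - s))]
  · have h1 : 3 * p ^ 2 ≤ A := by nlinarith
    have h2 : s ^ 2 * (3 * (p - s) ^ 2) ≤ s ^ 2 * A + 3 * s ^ 4 := by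
      have : 3 * (p - s) ^ 2 ≤ A + 3 * s ^ 2 := by nlinarith [mul_nonneg hp hs.le]
      nlinarith [mul_le_mul_of_nonneg_left this (sq_nonneg s)]
    have h3 : s ^ 2 * A ≤ A ^ 2 + s ^ 4 := by nlinarith [sq_nonneg (A - s ^ 2), sq_nonneg A]
    have h4 : 9 * s ^ 4 ≤ s ^ 2 * (q - s) ^ 2 := by
      have : (3 * s) ^ 2 ≤ (q - s) ^ 2 := by gcongr; linarith
      nlinarith [mul_le_mul_of_nonneg_left this (sq_nonneg s)]
    nlinarith [sq_nonneg A, mul_nonneg (sq_nonneg s) (sq_nonneg (q - s))]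

/-- **Quadratic coercivity of the bulk potential on the quadrant** `{x ≥ 0, y ≤ 0}`:
`f(x,y) − f(s₊/√2, −s₊/√6) ≥ α ((x − s₊/√2)² + (y + s₊/√6)²)` for some `α > 0`. -/
theorem stmt13 (a2 b2 c2 : ℝ) (ha : 0 ≤ a2) (hb : 0 < b2) (hc : 0 < c2) :
    ∃ α : ℝ, 0 < α ∧ ∀ x y : ℝ, 0 ≤ x → y ≤ 0 →
      α * ((x - sPlus a2 b2 c2 / Real.sqrt 2) ^ 2
          + (y + sPlus a2 b2 c2 / Real.sqrt 6) ^ 2)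
        ≤ fbulk a2 b2 c2 x y
          - fbulk a2 b2 c2 (sPlus a2 b2 c2 / Real.sqrt 2)
              (-(sPlus a2 b2 c2 / Real.sqrt 6)) := by
  have hs := sPlus_pos (a2 := a2) hb hc
  have hquad := sPlus_quadratic (b2 := b2) ha hc
  set s := sPlus a2 b2 c2
  refine ⟨b2 * s / 144, by positivity, fun x y hx hy => ?_⟩
  have h2 : Real.sqrt 2 ^ 2 = 2 := Real.sq_sqrt (by norm_num)
  have h6 : Real.sqrt 6 ^ 2 = 6 := Real.sq_sqrt (by norm_num)
  have h2' : 0 < Real.sqrt 2 := by positivity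
  have h6' : 0 < Real.sqrt 6 := by positivity
  obtain ⟨p, hp, rfl⟩ : ∃ p, 0 ≤ p ∧ x = p / Real.sqrt 2 :=
    ⟨x * Real.sqrt 2, by positivity, by field_simp⟩
  obtain ⟨q, hq, rfl⟩ : ∃ q, 0 ≤ q ∧ y = -(q / Real.sqrt 6) :=
    ⟨-y * Real.sqrt 6, mul_nonneg (neg_nonneg.2 hy) h6'.le, by field_simp⟩
  have hdist : (p / Real.sqrt 2 - s / Real.sqrt 2) ^ 2
      + (-(q / Real.sqrt 6) + s / Real.sqrt 6) ^ 2 = (3 * (p - s) ^ 2 + (q - s) ^ 2) / 6 := by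
    rw [← sub_div, ← neg_div, ← add_div, div_pow, div_pow, h2, h6]
    ring
  rw [hdist, fbulk_rescaled, fbulk_rescaled]
  have hcoer := mul_le_mul_of_nonneg_left (quartic_coercive hs hp hq)
    (show 0 ≤ b2 / (864 * s) by positivity)
  have hc2 : c2 = b2 / (2 * s) + 3 * a2 / (2 * s ^ 2) := by
    field_simp
    linear_combination hquad
  have hrest : 0 ≤ 3 * a2 / (2 * s ^ 2) * (3 * p ^ 2 + q ^ 2 - 4 * s ^ 2) ^ 2 / 144 := by
    positivity
  rw [hc2]
  calc
    _ = b2 / (864 * s) * (s ^ 2 * (3 * (p - s) ^ 2 + (q - s) ^ 2)) := by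
      field_simp
      ring
    _ ≤ _ := hcoer.trans (le_add_of_nonneg_right hrest)
    _ = _ := by
      field_simp
      ring

end
end

section
/- Hardy decomposition identity for the u-equation: Let a² ≥ 0, b², c² > 0, k ∈ ℤ \ {0}, R ∈ (0,∞]. Let u, v be C² real-valued functions on (0,R) with u > 0 on (0,R) satisfying u''(r) + u'(r)/r − (k²/r²)u(r) = h(u(r), v(r)) for all r ∈ (0,R). Then for every smooth function ξ̃ with compact support contained in (0,R), setting ξ(r) = u(r)ξ̃(r), one has ∫₀^R ( ξ'(r)² + (k²/r²)ξ(r)² ) r dr = ∫₀^R ( u(r)²·ξ̃'(r)² − h(u(r), v(r))·u(r)·ξ̃(r)² ) r dr. -/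
open Real MeasureTheory Filter Set Topology
open scoped ENNReal

noncomputable section

theorem isOpen_Iset (R : ℝ≥0∞) : IsOpen (Iset R) :=
  isOpen_Ioi.inter (isOpen_lt ENNReal.continuous_ofReal continuous_const)

theorem contDiff_of_forall_mem_tsupport {n : WithTop ℕ∞} {F : ℝ → ℝ}
    (h : ∀ x ∈ tsupport F, ContDiffAt ℝ n F x) : ContDiff ℝ n F :=
  contDiff_iff_contDiffAt.2 fun x => by
    by_cases hx : x ∈ tsupport F
    · exact h x hx
    · exact contDiffAt_const.congr_of_eventuallyEq (notMem_tsupport_iff_eventuallyEq.1 hx)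

theorem integral_deriv_eq_zero_of_hasCompactSupport {F : ℝ → ℝ} (hF : ContDiff ℝ 1 F)
    (hc : HasCompactSupport F) : ∫ x, deriv F x = 0 :=
  integral_eq_zero_of_hasDerivAt_of_integrable
    (fun x => (hF.differentiable one_ne_zero x).hasDerivAt)
    ((hF.continuous_deriv le_rfl).integrable_of_hasCompactSupport hc.deriv)
    (hF.continuous.integrable_of_hasCompactSupport hc)

/-- If two functions differ on `s` by the derivative of a `C¹` function compactly supported in `s`,
then they have the same integral over `s`. -/
theorem setIntegral_eq_of_eq_add_deriv {s : Set ℝ} (hs : MeasurableSet s) {f g F : ℝ → ℝ}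
    (hF : ContDiff ℝ 1 F) (hc : HasCompactSupport F) (hFs : tsupport F ⊆ s)
    (h : ∀ x ∈ s, f x = g x + deriv F x) : ∫ x in s, f x = ∫ x in s, g x := by
  have hint : IntegrableOn (deriv F) s :=
    ((hF.continuous_deriv le_rfl).integrable_of_hasCompactSupport hc.deriv).integrableOn
  have hzero : ∫ x in s, deriv F x = 0 := by
    rw [setIntegral_eq_integral_of_forall_compl_eq_zero
      fun x hx => deriv_of_notMem_tsupport fun hx' => hx (hFs hx')]
    exact integral_deriv_eq_zero_of_hasCompactSupport hF hc
  rw [setIntegral_congr_fun hs h]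
  by_cases hg : IntegrableOn g s
  · rw [integral_add hg hint, hzero, add_zero]
  · rw [integral_undef hg, integral_undef]
    exact fun hsum => hg ((integrable_add_iff_integrable_left hint).1 hsum)

/-- **Hardy decomposition identity for the `u`-equation**: if `u > 0` is C² on `(0,R)` and
solves `u'' + u'/r − (k²/r²)u = h(u,v)`, then for every smooth `ξ̃` compactly supported in
`(0,R)`, setting `ξ = u ξ̃`,
`∫₀^R (ξ'² + (k²/r²)ξ²) r dr = ∫₀^R (u² ξ̃'² − h(u,v) u ξ̃²) r dr`. -/
theorem stmt15 (a2 b2 c2 : ℝ) (ha : 0 ≤ a2) (hb : 0 < b2) (hc : 0 < c2)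
    (k : ℤ) (hk : k ≠ 0) (R : ℝ≥0∞) (hR : 0 < R)
    (u v : ℝ → ℝ)
    (hC2u : ContDiffOn ℝ 2 u (Iset R)) (hC2v : ContDiffOn ℝ 2 v (Iset R))
    (hu : ∀ r ∈ Iset R, 0 < u r)
    (hode : ∀ r ∈ Iset R,
      deriv (deriv u) r + deriv u r / r - (k : ℝ) ^ 2 / r ^ 2 * u r
        = hfun a2 b2 c2 (u r) (v r))
    (ξt : ℝ → ℝ) (hξt : ContDiff ℝ (⊤ : ℕ∞) ξt)
    (hξtc : HasCompactSupport ξt) (hξts : tsupport ξt ⊆ Iset R) :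
    ∫ r in Iset R,
        (deriv (fun s => u s * ξt s) r ^ 2 + (k : ℝ) ^ 2 / r ^ 2 * (u r * ξt r) ^ 2) * r
      = ∫ r in Iset R,
          (u r ^ 2 * deriv ξt r ^ 2 - hfun a2 b2 c2 (u r) (v r) * u r * ξt r ^ 2) * r := by
  have hopen := isOpen_Iset R
  have hu2 : ∀ r ∈ Iset R, ContDiffAt ℝ 2 u r := fun r hr => hC2u.contDiffAt (hopen.mem_nhds hr)
  have hdu : ∀ r ∈ Iset R, ContDiffAt ℝ 1 (deriv u) r := fun r hr =>
    (hC2u.deriv_of_isOpen hopen one_add_one_eq_two.le).contDiffAt (hopen.mem_nhds hr)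
  set F : ℝ → ℝ := fun r => r * u r * deriv u r * ξt r ^ 2 with hFdef
  have hsupp : tsupport F ⊆ tsupport ξt :=
    closure_mono fun r hr hξ => hr (by simp [hFdef, hξ])
  have hF : ContDiff ℝ 1 F := contDiff_of_forall_mem_tsupport fun r hr => by
    have hr' := hξts (hsupp hr)
    have hξ1 : ContDiffAt ℝ 1 ξt r := (hξt.of_le (by exact_mod_cast le_top)).contDiffAt
    exact ((contDiffAt_id.mul ((hu2 r hr').of_le one_le_two)).mul (hdu r hr')).mul (hξ1.pow 2)
  refine setIntegral_eq_of_eq_add_deriv hopen.measurableSet hF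
    (hξtc.of_isClosed_subset (isClosed_tsupport F) hsupp) (hsupp.trans hξts) fun r hr => ?_
  have hr0 : r ≠ 0 := hr.1.ne'
  have hu' : HasDerivAt u (deriv u r) r := ((hu2 r hr).differentiableAt two_ne_zero).hasDerivAt
  have hu'' : HasDerivAt (deriv u) (deriv (deriv u) r) r :=
    ((hdu r hr).differentiableAt one_ne_zero).hasDerivAt
  have hξ' : HasDerivAt ξt (deriv ξt r) r :=
    (hξt.differentiable (by simp) r).hasDerivAt
  have hF' := (((hasDerivAt_id r).mul hu').mul hu'').mul (hξ'.pow 2)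
  have hderivF : deriv F r = _ := hF'.deriv
  have hderiv : deriv (fun s => u s * ξt s) r = _ := (hu'.mul hξ').deriv
  rw [hderivF, hderiv, ← hode r hr]
  simp only [Pi.mul_apply, Pi.pow_apply, id]
  field_simp
  ring

end
end

section
/- Nonnegativity of the Fourier-mode quadratic form via completing squares: Let R ∈ (0,∞], let m ≥ 1 be an integer, and let u be a continuously differentiable function on (0,R) with u ≥ 0 and u' ≥ 0 on (0,R). Then for all smooth functions ξ, ζ with compact support contained in (0,R): ∫₀^R [ ((m² − 1)/r²)·u'(r)²·ξ(r)² + (m²/r²)·u(r)²·ζ(r)² + u(r)²·ζ'(r)² + (2/r³)·u(r)·u'(r)·ξ(r)² − (4m/r²)·u(r)·u'(r)·ξ(r)·ζ(r) ] r dr ≥ 0. -/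
open Real MeasureTheory Filter Set Topology
open scoped ENNReal

noncomputable section

/-- Pointwise nonnegativity of the quadratic form, after adding the derivative of `u² ζ²`. -/
theorem modeForm_add_deriv_nonneg {m r U V X Z W : ℝ} (hm : 1 ≤ m) (hr : 0 < r)
    (hU : 0 ≤ U) (hV : 0 ≤ V) :
    0 ≤ ((m ^ 2 - 1) / r ^ 2 * V ^ 2 * X ^ 2 + m ^ 2 / r ^ 2 * U ^ 2 * Z ^ 2
          + U ^ 2 * W ^ 2 + 2 / r ^ 3 * U * V * X ^ 2
          - 4 * m / r ^ 2 * U * V * X * Z) * r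
        + (2 * U * V * Z ^ 2 + 2 * U ^ 2 * Z * W) := by
  obtain ⟨x, rfl⟩ : ∃ x, X = r * x := ⟨X / r, by field_simp⟩
  have hk : 0 ≤ m ^ 2 - 1 := by nlinarith
  have hUV : 0 ≤ U * V := mul_nonneg hU hV
  have key : 0 ≤ (m ^ 2 - 1) * r * V ^ 2 * x ^ 2 + (m ^ 2 - 1) / r * U ^ 2 * Z ^ 2
      + 2 * (U * V) * (x ^ 2 - 2 * m * (x * Z) + Z ^ 2) := by
    rcases le_total (x * Z) 0 with h | h
    · have : 0 ≤ x ^ 2 - 2 * m * (x * Z) + Z ^ 2 := by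
        nlinarith [sq_nonneg x, sq_nonneg Z]
      positivity
    · have h1 : 0 ≤ (x - Z) ^ 2 + (m - 1) ^ 2 * (x * Z) := by positivity
      have h2 : 0 ≤ (m ^ 2 - 1) / r * (r * V * x - U * Z) ^ 2 := by positivity
      have h3 : 0 ≤ 2 * (U * V) * ((x - Z) ^ 2 + (m - 1) ^ 2 * (x * Z)) := by positivity
      refine (add_nonneg h2 h3).trans_eq ?_
      field_simp
      ring
  have hsq : 0 ≤ r * U ^ 2 * (W + Z / r) ^ 2 := by positivity
  refine (add_nonneg hsq key).trans_eq ?_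
  field_simp
  ring

/-- The product of a function that is `C¹` on an open set with a `C¹` function supported in that
set is `C¹` everywhere. -/
theorem contDiff_mul_of_tsupport_subset {s : Set ℝ} (hs : IsOpen s) {f g : ℝ → ℝ}
    (hf : ContDiffOn ℝ 1 f s) (hg : ContDiff ℝ 1 g) (hgs : tsupport g ⊆ s) :
    ContDiff ℝ 1 (fun r => f r * g r) := by
  refine contDiff_iff_contDiffAt.2 fun r => ?_
  by_cases hr : r ∈ tsupport (fun r => f r * g r)
  swap
  · exact contDiffAt_const.congr_of_eventuallyEq (notMem_tsupport_iff_eventuallyEq.1 hr)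
  have hrs : r ∈ s := hgs (tsupport_mul_subset_right hr)
  exact (hf.contDiffAt (hs.mem_nhds hrs)).mul hg.contDiffAt

/-- A compactly supported `C¹` function on `ℝ` has an integrable derivative of zero integral. -/
theorem integral_deriv_eq_zero_of_hasCompactSupport_s16 {g : ℝ → ℝ} (hg : ContDiff ℝ 1 g)
    (hc : HasCompactSupport g) : Integrable (deriv g) ∧ ∫ r, deriv g r = 0 := by
  have hint : Integrable (deriv g) :=
    (hg.continuous_deriv le_rfl).integrable_of_hasCompactSupport hc.deriv
  exact ⟨hint, integral_eq_zero_of_hasDerivAt_of_integrable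
    (fun r => (hg.differentiable one_ne_zero r).hasDerivAt) hint
    (hg.continuous.integrable_of_hasCompactSupport hc)⟩

/-- **Nonnegativity of the Fourier-mode quadratic form via completing squares**: for
`m ≥ 1`, `u` C¹ with `u ≥ 0` and `u' ≥ 0` on `(0,R)`, and all smooth `ξ, ζ` compactly
supported in `(0,R)`, the mode-`m` quadratic form is nonnegative. -/
theorem stmt16 (R : ℝ≥0∞) (hR : 0 < R) (m : ℤ) (hm : 1 ≤ m)
    (u : ℝ → ℝ) (hC1u : ContDiffOn ℝ 1 u (Iset R))
    (hu : ∀ r ∈ Iset R, 0 ≤ u r) (hu' : ∀ r ∈ Iset R, 0 ≤ deriv u r)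
    (ξ ζ : ℝ → ℝ) (hξ : ContDiff ℝ (⊤ : ℕ∞) ξ) (hζ : ContDiff ℝ (⊤ : ℕ∞) ζ)
    (hξc : HasCompactSupport ξ) (hζc : HasCompactSupport ζ)
    (hξs : tsupport ξ ⊆ Iset R) (hζs : tsupport ζ ⊆ Iset R) :
    0 ≤ ∫ r in Iset R,
        (((m : ℝ) ^ 2 - 1) / r ^ 2 * deriv u r ^ 2 * ξ r ^ 2
          + (m : ℝ) ^ 2 / r ^ 2 * u r ^ 2 * ζ r ^ 2
          + u r ^ 2 * deriv ζ r ^ 2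
          + 2 / r ^ 3 * u r * deriv u r * ξ r ^ 2
          - 4 * (m : ℝ) / r ^ 2 * u r * deriv u r * ξ r * ζ r) * r := by
  set g : ℝ → ℝ := fun r => u r ^ 2 * ζ r ^ 2
  have hopen := isOpen_Iset R
  have hsupp : tsupport (fun r => ζ r ^ 2) ⊆ tsupport ζ :=
    closure_mono fun r hr h => hr (by simp [h])
  have hgsupp : tsupport g ⊆ Iset R :=
    (tsupport_mul_subset_right.trans hsupp).trans hζs
  have hgC : ContDiff ℝ 1 g := contDiff_mul_of_tsupport_subset hopen (hC1u.pow 2)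
    ((hζ.of_le (mod_cast le_top)).pow 2) (hsupp.trans hζs)
  have hgc : HasCompactSupport g :=
    hζc.of_isClosed_subset (isClosed_tsupport g) (tsupport_mul_subset_right.trans hsupp)
  obtain ⟨hint, hzero⟩ := integral_deriv_eq_zero_of_hasCompactSupport_s16 hgC hgc
  have hset : ∫ r in Iset R, deriv g r = 0 := by
    rw [setIntegral_eq_integral_of_forall_compl_eq_zero, hzero]
    intro r hr
    by_contra h
    exact hr (hgsupp (support_deriv_subset h))
  by_cases hQ : IntegrableOn (fun r => (((m : ℝ) ^ 2 - 1) / r ^ 2 * deriv u r ^ 2 * ξ r ^ 2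
          + (m : ℝ) ^ 2 / r ^ 2 * u r ^ 2 * ζ r ^ 2
          + u r ^ 2 * deriv ζ r ^ 2
          + 2 / r ^ 3 * u r * deriv u r * ξ r ^ 2
          - 4 * (m : ℝ) / r ^ 2 * u r * deriv u r * ξ r * ζ r) * r) (Iset R)
  · refine le_of_le_of_eq ?_ ((integral_add hQ hint.integrableOn).trans (by rw [hset, add_zero]))
    refine setIntegral_nonneg hopen.measurableSet fun r hr => ?_
    have hud : HasDerivAt u (deriv u r) r :=
      ((hC1u.differentiableOn one_ne_zero).differentiableAt (hopen.mem_nhds hr)).hasDerivAt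
    have hζd : HasDerivAt ζ (deriv ζ r) r := (hζ.differentiable (by simp) r).hasDerivAt
    have hgd : deriv g r = 2 * u r * deriv u r * ζ r ^ 2 + 2 * u r ^ 2 * ζ r * deriv ζ r := by
      refine ((hud.pow 2).mul (hζd.pow 2)).deriv.trans ?_
      simp only [Pi.pow_apply]
      ring
    rw [hgd]
    exact modeForm_add_deriv_nonneg (mod_cast hm) hr.1 (hu r hr) (hu' r hr)
  · exact (integral_undef hQ).ge
end
end

section
/- Monotonicity from concavity of r·u' and convergence: Let R₀ ≥ 0 and let u : (R₀,∞) → ℝ be twice continuously differentiable. Suppose that the derivative of the function r ↦ r·u'(r) is strictly negative on (R₀,∞), and that u(r) converges to a finite limit as r → ∞. Then u'(r) > 0 for all r ∈ (R₀,∞). -/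
open Real MeasureTheory Filter Set Topology
open scoped ENNReal

noncomputable section

/-- **Monotonicity from concavity of `r u'` and convergence**: if `u` is C² on `(R₀,∞)`,
the derivative of `r ↦ r u'(r)` is strictly negative there, and `u` converges to a finite
limit at infinity, then `u' > 0` on `(R₀,∞)`. -/
theorem stmt17 (R₀ : ℝ) (hR₀ : 0 ≤ R₀) (u : ℝ → ℝ)
    (hC2 : ContDiffOn ℝ 2 u (Set.Ioi R₀))
    (hconc : ∀ r ∈ Set.Ioi R₀, deriv (fun s => s * deriv u s) r < 0)
    (hlim : ∃ L : ℝ, Filter.Tendsto u Filter.atTop (nhds L)) :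
    ∀ r ∈ Set.Ioi R₀, 0 < deriv u r := by
  intro a ha
  obtain ⟨L, hL⟩ := hlim
  have ha0 : 0 < a := hR₀.trans_lt ha
  have hanti : StrictAntiOn (fun s => s * deriv u s) (Set.Ioi R₀) := by
    refine strictAntiOn_of_deriv_neg (convex_Ioi R₀) (fun r hr => ?_) (fun r hr => ?_)
    · exact (differentiableAt_of_deriv_ne_zero (hconc r hr).ne).continuousAt.continuousWithinAt
    · exact hconc r (interior_subset hr)
  have hdiff : ∀ r ∈ Set.Ioi R₀, DifferentiableAt ℝ u r := fun r hr =>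
    (hC2.contDiffAt (Ioi_mem_nhds hr)).differentiableAt (by norm_num)
  by_contra! hneg
  have hb : a + 1 ∈ Set.Ioi R₀ := ha.trans (lt_add_one a)
  obtain ⟨c, hc⟩ : ∃ c, c = -((a + 1) * deriv u (a + 1)) := ⟨_, rfl⟩
  have hc0 : 0 < c := by
    have h := hanti ha hb (lt_add_one a)
    have h' := mul_nonpos_of_nonneg_of_nonpos ha0.le hneg
    simp only at h
    linarith
  have hderiv : ∀ r ∈ Set.Ici (a + 1),
      HasDerivAt (fun s => u s + c * Real.log s) (deriv u r + c * r⁻¹) r := by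
    intro r hr
    have hr' : a + 1 ≤ r := hr
    exact (hdiff r (hb.trans_le hr')).hasDerivAt.add
      ((Real.hasDerivAt_log (by linarith)).const_mul c)
  have hle : AntitoneOn (fun s => u s + c * Real.log s) (Set.Ici (a + 1)) := by
    refine antitoneOn_of_deriv_nonpos (convex_Ici _)
      (fun r hr => (hderiv r hr).continuousAt.continuousWithinAt)
      (fun r hr => (hderiv r (interior_subset hr)).differentiableAt.differentiableWithinAt)
      (fun r hr => ?_)
    have hr' : a + 1 ≤ r := interior_subset hr
    have hr0 : 0 < r := by linarith
    rw [(hderiv r hr').deriv]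
    have h : r * deriv u r ≤ (a + 1) * deriv u (a + 1) :=
      hanti.antitoneOn hb (hb.trans_le hr') hr'
    have h' : deriv u r + c * r⁻¹ = (r * deriv u r + c) / r := by field_simp
    rw [h']
    exact div_nonpos_of_nonpos_of_nonneg (by linarith) hr0.le
  have htop : Tendsto (fun s => u s + c * Real.log s) atTop atTop :=
    hL.add_atTop (Real.tendsto_log_atTop.const_mul_atTop hc0)
  obtain ⟨r, hr, hr'⟩ := ((htop.eventually_gt_atTop (u (a + 1) + c * Real.log (a + 1))).and
    (eventually_ge_atTop (a + 1))).exists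
  exact (hle Set.self_mem_Ici hr' hr').not_gt hr

end
end

section
/- Derivative asymptotics by integration from infinity: Let R₀ > 0, let u : (R₀,∞) → ℝ be twice continuously differentiable, and let p₁ ∈ ℝ. Suppose that r·u'(r) → 0 as r → ∞ and that there exist constants C > 0 and R₁ ≥ R₀ such that |(d/dr)(r·u'(r)) − 4p₁·r⁻³| ≤ C·r⁻⁵ for all r ≥ R₁. Then there exist constants C' > 0 and R₂ ≥ R₁ such that |u'(r) + 2p₁·r⁻³| ≤ C'·r⁻⁵ for all r ≥ R₂. -/
open Real MeasureTheory Filter Set Topology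
open scoped ENNReal

noncomputable section

/-- A function on a half-line with nonnegative derivative is bounded above by its limit
at infinity. -/
theorem le_of_tendsto_of_hasDerivAt_nonneg {f f' : ℝ → ℝ} {a l : ℝ}
    (hf : ∀ x ∈ Set.Ioi a, HasDerivAt f (f' x) x) (hf' : ∀ x ∈ Set.Ioi a, 0 ≤ f' x)
    (hl : Filter.Tendsto f Filter.atTop (nhds l)) {x : ℝ} (hx : a < x) : f x ≤ l := by
  have hmono : MonotoneOn f (Set.Ioi a) := by
    refine monotoneOn_of_deriv_nonneg (convex_Ioi a)
      (fun y hy => (hf y hy).continuousAt.continuousWithinAt) ?_ ?_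
    · rw [interior_Ioi]
      exact fun y hy => (hf y hy).differentiableAt.differentiableWithinAt
    · rw [interior_Ioi]
      intro y hy
      rw [(hf y hy).deriv]
      exact hf' y hy
  refine ge_of_tendsto hl ?_
  filter_upwards [Filter.eventually_ge_atTop x] with y hy
  exact hmono hx (hx.trans_le hy) hy

/-- Derivative of `x ↦ c / x ^ n`. -/
theorem hasDerivAt_const_div_pow (c : ℝ) (n : ℕ) {x : ℝ} (hx : x ≠ 0) :
    HasDerivAt (fun y : ℝ => c / y ^ n) (-(n * c) / x ^ (n + 1)) x := by
  have h := ((hasDerivAt_pow n x).inv (pow_ne_zero n hx)).const_mul c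
  refine (h.congr_deriv ?_).congr_of_eventuallyEq ?_
  · rcases n with _ | n
    · simp
    · simp only [Nat.add_sub_cancel]
      field_simp
      ring
  · exact Filter.Eventually.of_forall fun y => by simp [div_eq_mul_inv]

/-- **Derivative asymptotics by integration from infinity**: if `r u'(r) → 0` at infinity
and `|(r u')' − 4p₁ r⁻³| ≤ C r⁻⁵` for `r ≥ R₁`, then `|u' + 2p₁ r⁻³| ≤ C' r⁻⁵` for
`r ≥ R₂`, for some `C' > 0` and `R₂ ≥ R₁`. -/
theorem stmt18 (R₀ : ℝ) (hR₀ : 0 < R₀) (u : ℝ → ℝ) (p₁ : ℝ)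
    (hC2 : ContDiffOn ℝ 2 u (Set.Ioi R₀))
    (hlim : Filter.Tendsto (fun r => r * deriv u r) Filter.atTop (nhds 0))
    (C R₁ : ℝ) (hC : 0 < C) (hR₁ : R₀ ≤ R₁)
    (hbound : ∀ r : ℝ, R₁ ≤ r →
      |deriv (fun s => s * deriv u s) r - 4 * p₁ / r ^ 3| ≤ C / r ^ 5) :
    ∃ C' R₂ : ℝ, 0 < C' ∧ R₁ ≤ R₂ ∧
      ∀ r : ℝ, R₂ ≤ r → |deriv u r + 2 * p₁ / r ^ 3| ≤ C' / r ^ 5 := by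
  have hderiv : ∀ x, R₀ < x → HasDerivAt (fun s => s * deriv u s)
      (deriv (fun s => s * deriv u s) x) x := by
    intro x hx
    have h1 : ContDiffOn ℝ 1 (deriv u) (Set.Ioi R₀) :=
      hC2.deriv_of_isOpen isOpen_Ioi (by norm_num)
    have h2 : DifferentiableAt ℝ (deriv u) x :=
      (h1.differentiableOn (by norm_num)).differentiableAt (Ioi_mem_nhds hx)
    exact (differentiableAt_id.mul h2).hasDerivAt
  have hdecay : ∀ (c : ℝ) (n : ℕ), n ≠ 0 →
      Filter.Tendsto (fun r : ℝ => c / r ^ n) Filter.atTop (nhds 0) := fun c n hn =>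
    tendsto_const_nhds.div_atTop (Filter.tendsto_pow_atTop hn)
  have hupper : ∀ r, R₁ < r → r * deriv u r + 2 * p₁ / r ^ 2 - C / 4 / r ^ 4 ≤ 0 := by
    intro r hr
    refine le_of_tendsto_of_hasDerivAt_nonneg
      (f := fun r => r * deriv u r + 2 * p₁ / r ^ 2 - C / 4 / r ^ 4) (a := R₁)
      (fun x hx => ((hderiv x (hR₁.trans_lt hx)).add
        (hasDerivAt_const_div_pow (2 * p₁) 2 (hR₀.trans (hR₁.trans_lt hx)).ne')).sub
        (hasDerivAt_const_div_pow (C / 4) 4 (hR₀.trans (hR₁.trans_lt hx)).ne')) ?_ ?_ hr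
    · intro x hx
      have h := (abs_le.1 (hbound x (le_of_lt hx))).1
      push_cast
      ring_nf at h ⊢
      linarith
    · simpa using (hlim.add (hdecay (2 * p₁) 2 (by norm_num))).sub
        (hdecay (C / 4) 4 (by norm_num))
  have hlower : ∀ r, R₁ < r → -(r * deriv u r + 2 * p₁ / r ^ 2) - C / 4 / r ^ 4 ≤ 0 := by
    intro r hr
    refine le_of_tendsto_of_hasDerivAt_nonneg
      (f := fun r => -(r * deriv u r + 2 * p₁ / r ^ 2) - C / 4 / r ^ 4) (a := R₁)
      (fun x hx => ((hderiv x (hR₁.trans_lt hx)).add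
        (hasDerivAt_const_div_pow (2 * p₁) 2 (hR₀.trans (hR₁.trans_lt hx)).ne')).neg.sub
        (hasDerivAt_const_div_pow (C / 4) 4 (hR₀.trans (hR₁.trans_lt hx)).ne')) ?_ ?_ hr
    · intro x hx
      have h := (abs_le.1 (hbound x (le_of_lt hx))).2
      push_cast
      ring_nf at h ⊢
      linarith
    · simpa using (hlim.add (hdecay (2 * p₁) 2 (by norm_num))).neg.sub
        (hdecay (C / 4) 4 (by norm_num))
  refine ⟨C / 4, R₁ + 1, by positivity, by linarith, fun r hr => ?_⟩
  have hr₁ : R₁ < r := by linarith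
  have hr₀ : 0 < r := hR₀.trans (hR₁.trans_lt hr₁)
  have hg : |r * deriv u r + 2 * p₁ / r ^ 2| ≤ C / 4 / r ^ 4 :=
    abs_le.2 ⟨by linarith [hlower r hr₁], by linarith [hupper r hr₁]⟩
  have hu : deriv u r + 2 * p₁ / r ^ 3 = (r * deriv u r + 2 * p₁ / r ^ 2) / r := by
    field_simp
  have hC' : C / 4 / r ^ 5 = C / 4 / r ^ 4 / r := by
    field_simp
  rw [hu, hC', abs_div, abs_of_pos hr₀]
  exact div_le_div_of_nonneg_right hg hr₀.le

end
end

section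
/- Weighted L¹ bound from the weighted H¹ norm: There exists a constant C > 0 such that for every continuously differentiable function w : (0,∞) → ℝ with N² := ∫₀^∞ (w'(r)² + w(r)²) r dr < ∞, one has ∫₀^{1/2} |w(r)| dr + ∫_{1/2}^∞ (|w(r)|/r) dr ≤ C·N. -/
open Real MeasureTheory Filter Set Topology
open scoped ENNReal

noncomputable section

theorem le_mul_sqrt_of_forall_le_mul_add_div {A M c : ℝ} (hM : 0 ≤ M)
    (h : ∀ t : ℝ, 0 < t → A ≤ t * M + c / t) : A ≤ (1 + c) * √M := by
  rcases hM.eq_or_lt with rfl | hM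
  · have hlim : Tendsto (fun t : ℝ => t * 0 + c / t) atTop (𝓝 0) := by
      simpa using tendsto_const_nhds.div_atTop (tendsto_id (α := ℝ) (x := atTop))
    have : A ≤ 0 := ge_of_tendsto hlim ((eventually_gt_atTop 0).mono h)
    simpa using this
  · have hs : 0 < √M := Real.sqrt_pos.2 hM
    have h1 := h (1 / √M) (by positivity)
    have h2 : 1 / √M * M + c / (1 / √M) = (1 + c) * √M := by
      nth_rewrite 2 [← Real.mul_self_sqrt hM.le]
      field_simp
    linarith

theorem energy_nonneg (w : ℝ → ℝ) {r : ℝ} (hr : 0 < r) :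
    0 ≤ (deriv w r ^ 2 + w r ^ 2) * r := by positivity

/-- The derivative of `r (1 - r) √(w² + δ²)` controls `|w|` up to energy terms. -/
theorem abs_sub_energy_le {t r a b : ℝ} (ht : 0 < t) (hr : 0 < r) (hr1 : r < 1) :
    |a| - t / 2 * ((b ^ 2 + a ^ 2) * r) - 9 / (2 * t) ≤
      (1 - 2 * r) * √(a ^ 2 + (1 / t) ^ 2) +
        (r - r ^ 2) * (2 * a * b / (2 * √(a ^ 2 + (1 / t) ^ 2))) := by
  set d := 1 / t with hd
  have hd0 : 0 < d := by positivity
  set g := √(a ^ 2 + d ^ 2) with hg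
  have hg2 : g ^ 2 = a ^ 2 + d ^ 2 := Real.sq_sqrt (by positivity)
  have hg0 : 0 < g := Real.sqrt_pos.2 (by positivity)
  have hag : |a| ≤ g := Real.abs_le_sqrt (by nlinarith)
  have hgd : g ≤ |a| + d := by
    apply Real.sqrt_le_iff.2 ⟨by positivity, ?_⟩
    nlinarith [sq_abs a, mul_nonneg (abs_nonneg a) hd0.le]
  have hq : -|b| ≤ 2 * a * b / (2 * g) := by
    rw [le_div_iff₀ (by positivity)]
    have h1 : |a| * |b| ≤ g * |b| := by gcongr
    have h2 := neg_abs_le (a * b)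
    rw [abs_mul] at h2
    nlinarith
  have hrr : 0 ≤ r - r ^ 2 := by nlinarith
  have h3 : -(r * |b|) ≤ (r - r ^ 2) * (2 * a * b / (2 * g)) := by
    have := mul_le_mul_of_nonneg_left hq hrr
    nlinarith [mul_nonneg (sq_nonneg r) (abs_nonneg b)]
  have h4 : |b| ≤ t / 2 * b ^ 2 + d / 2 := by
    have : t / 2 * b ^ 2 + d / 2 - |b| = t / 2 * (|b| - d) ^ 2 := by
      rw [← sq_abs b, hd]; field_simp; ring
    nlinarith [mul_nonneg ht.le (sq_nonneg (|b| - d))]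
  have h5 : 2 * |a| ≤ t / 2 * a ^ 2 + 2 * d := by
    have : t / 2 * a ^ 2 + 2 * d - 2 * |a| = t / 2 * (|a| - 2 * d) ^ 2 := by
      rw [← sq_abs a, hd]; field_simp; ring
    nlinarith [mul_nonneg ht.le (sq_nonneg (|a| - 2 * d))]
  have h6 : 9 / (2 * t) = 9 / 2 * d := by rw [hd]; field_simp
  have h7 : r * (|b| + 2 * g) ≤ r * (t / 2 * (b ^ 2 + a ^ 2) + 9 / 2 * d) :=
    mul_le_mul_of_nonneg_left (by linarith) hr.le
  rw [h6]
  nlinarith [mul_pos hd0 (sub_pos.2 hr1)]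

theorem integral_abs_Ioc_le {w : ℝ → ℝ} (hw : ContDiffOn ℝ 1 w (Ioi 0))
    (hE : IntegrableOn (fun r => (deriv w r ^ 2 + w r ^ 2) * r) (Ioi (0 : ℝ)))
    {t e : ℝ} (ht : 0 < t) (he : 0 < e) (he1 : e ≤ 1 / 2) :
    ∫ r in e..(1 / 2 : ℝ), |w r| ≤
      t / 2 * (∫ r in Ioi (0 : ℝ), (deriv w r ^ 2 + w r ^ 2) * r) + 9 / (2 * t) := by
  have hsub : Icc e 1 ⊆ Ioi (0 : ℝ) := fun x hx => he.trans_le hx.1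
  have hwc : ContinuousOn w (Icc e 1) := hw.continuousOn.mono hsub
  have hwi : IntegrableOn (fun r => |w r|) (Icc e 1) := hwc.abs.integrableOn_Icc
  have hEi := hE.mono_set hsub
  have hci : IntegrableOn (fun _ : ℝ => 9 / (2 * t)) (Icc e 1) :=
    continuousOn_const.integrableOn_Icc
  have hpos : ∀ x : ℝ, 0 < w x ^ 2 + (1 / t) ^ 2 := fun x => by positivity
  have key := intervalIntegral.integral_le_sub_of_hasDeriv_right_of_le
    (g := fun r => (r - r ^ 2) * √(w r ^ 2 + (1 / t) ^ 2))
    (g' := fun r => (1 - 2 * r) * √(w r ^ 2 + (1 / t) ^ 2) +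
        (r - r ^ 2) * (2 * w r * deriv w r / (2 * √(w r ^ 2 + (1 / t) ^ 2))))
    (φ := fun r => |w r| - t / 2 * ((deriv w r ^ 2 + w r ^ 2) * r) - 9 / (2 * t))
    (a := e) (b := 1) (by linarith) (by fun_prop)
    (fun x hx => by
      have hx0 : 0 < x := he.trans hx.1
      have h1 : HasDerivAt w (deriv w x) x :=
        ((hw.differentiableOn one_ne_zero).differentiableAt (Ioi_mem_nhds hx0)).hasDerivAt
      have h2 := ((h1.pow 2).add_const ((1 / t) ^ 2)).sqrt (hpos x).ne'
      have h3 := ((hasDerivAt_id x).sub ((hasDerivAt_id x).pow 2)).mul h2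
      exact (h3.congr_deriv (by simp)).hasDerivWithinAt)
    ((hwi.sub (hEi.const_mul _)).sub hci)
    (fun x hx => abs_sub_energy_le ht (he.trans hx.1) hx.2)
  have hii {f : ℝ → ℝ} (hf : IntegrableOn f (Icc e 1)) : IntervalIntegrable f volume e 1 :=
    (intervalIntegrable_iff_integrableOn_Icc_of_le (by linarith)).2 hf
  rw [intervalIntegral.integral_sub ((hii hwi).sub ((hii hEi).const_mul _)) (hii hci),
    intervalIntegral.integral_sub (hii hwi) ((hii hEi).const_mul _),
    intervalIntegral.integral_const_mul, intervalIntegral.integral_const, smul_eq_mul] at key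
  have hmono : ∫ r in e..(1 / 2 : ℝ), |w r| ≤ ∫ r in e..(1 : ℝ), |w r| :=
    intervalIntegral.integral_mono_interval le_rfl he1 (by norm_num)
      (ae_of_all _ fun x => abs_nonneg _) (hii hwi)
  have hEle : ∫ r in e..(1 : ℝ), (deriv w r ^ 2 + w r ^ 2) * r ≤
      ∫ r in Ioi (0 : ℝ), (deriv w r ^ 2 + w r ^ 2) * r := by
    rw [intervalIntegral.integral_of_le (by linarith)]
    exact setIntegral_mono_set hE
      ((ae_restrict_mem measurableSet_Ioi).mono fun x hx => energy_nonneg w hx)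
      (LE.le.eventuallyLE fun x hx => he.trans hx.1)
  have hge : 0 ≤ (e - e ^ 2) * √(w e ^ 2 + (1 / t) ^ 2) :=
    mul_nonneg (by nlinarith) (Real.sqrt_nonneg _)
  have ht9 : 0 < 9 / (2 * t) := by positivity
  have := mul_le_mul_of_nonneg_left hEle (by positivity : 0 ≤ t / 2)
  have hone : ((1 : ℝ) - 1 ^ 2) * √(w 1 ^ 2 + (1 / t) ^ 2) = 0 := by simp
  rw [hone] at key
  nlinarith [mul_pos he ht9]

theorem integral_abs_Ioo_le {w : ℝ → ℝ} (hw : ContDiffOn ℝ 1 w (Ioi 0))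
    (hE : IntegrableOn (fun r => (deriv w r ^ 2 + w r ^ 2) * r) (Ioi (0 : ℝ)))
    {t : ℝ} (ht : 0 < t) :
    ∫ r in Ioo (0 : ℝ) (1 / 2 : ℝ), |w r| ≤
      t / 2 * (∫ r in Ioi (0 : ℝ), (deriv w r ^ 2 + w r ^ 2) * r) + 9 / (2 * t) := by
  by_cases hi : IntegrableOn (fun r => |w r|) (Ioo (0 : ℝ) (1 / 2 : ℝ))
  · rw [← integral_Icc_eq_integral_Ioo, integral_Icc_eq_integral_Ioc,
      ← intervalIntegral.integral_of_le (by norm_num)]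
    have hc := intervalIntegral.continuousOn_primitive_interval_left
      (f := fun r => |w r|) (a := 0) (b := 1 / 2) (μ := volume)
      (by rw [uIcc_of_le (by norm_num)]; exact (integrableOn_Icc_iff_integrableOn_Ioo).2 hi)
    rw [uIcc_of_le (by norm_num)] at hc
    have hlim := (hc 0 (by norm_num)).mono_left
      (nhdsWithin_mono (0 : ℝ) (Ioc_subset_Icc_self (a := (0 : ℝ)) (b := 1 / 2)))
    rw [nhdsWithin_Ioc_eq_nhdsGT (by norm_num)] at hlim
    refine le_of_tendsto hlim ?_
    filter_upwards [Ioc_mem_nhdsGT (show (0 : ℝ) < 1 / 2 by norm_num)] with e he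
    exact integral_abs_Ioc_le hw hE ht he.1 he.2
  · rw [integral_undef hi]
    have := setIntegral_nonneg (μ := volume) measurableSet_Ioi fun r hr => energy_nonneg w (r := r) hr
    positivity

theorem integral_abs_div_Ioi_le {w : ℝ → ℝ}
    (hE : IntegrableOn (fun r => (deriv w r ^ 2 + w r ^ 2) * r) (Ioi (0 : ℝ)))
    {t : ℝ} (ht : 0 < t) :
    ∫ r in Ioi (1 / 2 : ℝ), |w r| / r ≤
      t / 2 * (∫ r in Ioi (0 : ℝ), (deriv w r ^ 2 + w r ^ 2) * r) + 1 / t := by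
  have hsub : Ioi (1 / 2 : ℝ) ⊆ Ioi 0 := Ioi_subset_Ioi (by norm_num)
  have hEi := (hE.mono_set hsub).const_mul (t / 2)
  have hpi := (integrableOn_Ioi_rpow_of_lt (a := -3) (by norm_num)
    (show (0 : ℝ) < 1 / 2 by norm_num)).const_mul (1 / (2 * t))
  have hpv : ∫ r in Ioi (1 / 2 : ℝ), r ^ (-3 : ℝ) = 2 := by
    rw [integral_Ioi_rpow_of_lt (by norm_num) (by norm_num),
      show (-3 : ℝ) + 1 = ((-2 : ℤ) : ℝ) by norm_num, Real.rpow_intCast]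
    norm_num
  have hle : ∫ r in Ioi (1 / 2 : ℝ), |w r| / r ≤ ∫ r in Ioi (1 / 2 : ℝ),
      (t / 2 * ((deriv w r ^ 2 + w r ^ 2) * r) + 1 / (2 * t) * r ^ (-3 : ℝ)) := by
    refine integral_mono_of_nonneg
      ((ae_restrict_mem measurableSet_Ioi).mono fun r hr => ?_) (hEi.add hpi)
      ((ae_restrict_mem measurableSet_Ioi).mono fun r hr => ?_)
    · exact div_nonneg (abs_nonneg _) (hsub hr : 0 < r).le
    · have hr0 : 0 < r := hsub hr
      have h1 : t / 2 * (w r ^ 2 * r) + 1 / (2 * t) * r ^ (-3 : ℝ) - |w r| / r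
          = r / (2 * t) * (t * |w r| - 1 / r ^ 2) ^ 2 := by
        rw [← sq_abs (w r), show (-3 : ℝ) = ((-3 : ℤ) : ℝ) by norm_num, Real.rpow_intCast,
          zpow_neg]
        norm_cast
        field_simp
        ring
      have h2 : 0 ≤ r / (2 * t) * (t * |w r| - 1 / r ^ 2) ^ 2 := by positivity
      have h3 : 0 ≤ t / 2 * (deriv w r ^ 2 * r) := by positivity
      show |w r| / r ≤ _
      linarith
  rw [integral_add hEi hpi, integral_const_mul, integral_const_mul, hpv] at hle
  have hEle : ∫ r in Ioi (1 / 2 : ℝ), (deriv w r ^ 2 + w r ^ 2) * r ≤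
      ∫ r in Ioi (0 : ℝ), (deriv w r ^ 2 + w r ^ 2) * r :=
    setIntegral_mono_set hE
      ((ae_restrict_mem measurableSet_Ioi).mono fun x hx => energy_nonneg w hx)
      (LE.le.eventuallyLE hsub)
  have h4 := mul_le_mul_of_nonneg_left hEle (by positivity : 0 ≤ t / 2)
  have h5 : 1 / (2 * t) * 2 = 1 / t := by field_simp
  linarith

/-- **Weighted L¹ bound from the weighted H¹ norm**: there is `C > 0` such that every C¹
function `w` on `(0,∞)` with `N² = ∫₀^∞ (w'² + w²) r dr < ∞` satisfies
`∫₀^{1/2} |w| dr + ∫_{1/2}^∞ |w|/r dr ≤ C N`. -/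
theorem stmt19 : ∃ C : ℝ, 0 < C ∧ ∀ w : ℝ → ℝ, ContDiffOn ℝ 1 w (Set.Ioi 0) →
    IntegrableOn (fun r => (deriv w r ^ 2 + w r ^ 2) * r) (Set.Ioi (0:ℝ)) →
    (∫ r in Set.Ioo (0:ℝ) (1/2 : ℝ), |w r|) + ∫ r in Set.Ioi (1/2 : ℝ), |w r| / r
      ≤ C * Real.sqrt (∫ r in Set.Ioi (0:ℝ), (deriv w r ^ 2 + w r ^ 2) * r) := by
  refine ⟨1 + 11 / 2, by norm_num, fun w hw hE => ?_⟩
  refine le_mul_sqrt_of_forall_le_mul_add_div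
    (setIntegral_nonneg measurableSet_Ioi fun r hr => energy_nonneg w hr) fun t ht => ?_
  have h1 := integral_abs_Ioo_le hw hE ht
  have h2 := integral_abs_div_Ioi_le hE ht
  have h3 : 9 / (2 * t) + 1 / t = 11 / 2 / t := by field_simp; norm_num
  linarith

end
end
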